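/- Let H ∈ (0, 3/4) and β = 2H−1. Define L₁(T) = ∫₀^T e^{−t₁} (∫_{[0,t₁]³} e^{s₁−|t₂−s₂|} (t₁−t₂)^β |s₁−s₂|^β sgn(t₂−s₂) sgn(s₁−s₂) dt₂ ds₁ ds₂) dt₁. Then, as T → ∞, L₁(T) = (1/2)·Γ(2H)²·(4H−1)·(1 − 1/cos(2Hπ))·(T − (4H+1)/2) − 2H²Γ(2H)² + T^{4H−2}/(2(4H−3)) − ((4H−2)/(4H−3))·T^{4H−3} + O(T^{4H−4}), where for H = 1/4 the coefficient (4H−1)(1 − 1/cos(2Hπ)) is interpreted as its limiting value 2/π. -/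

import Mathlib

open Real MeasureTheory intervalIntegral

noncomputable def L1 (β T : ℝ) : ℝ :=
  ∫ t₁ in (0:ℝ)..T, Real.exp (-t₁) *
    ∫ t₂ in (0:ℝ)..t₁, ∫ s₁ in (0:ℝ)..t₁, ∫ s₂ in (0:ℝ)..t₁,
      Real.exp (s₁ - |t₂ - s₂|) * (t₁ - t₂) ^ β * |s₁ - s₂| ^ β *
        Real.sign (t₂ - s₂) * Real.sign (s₁ - s₂)

/-- `σ_H²`, with the value at `H = 1/4` interpreted as the limit `2/π`. -/
noncomputable def sigmaH2 (H : ℝ) : ℝ :=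
  if H = 1/4 then 2 / π else (4 * H - 1) * (1 - 1 / Real.cos (2 * H * π))

namespace RosenblattAsymptotics

open Filter Topology Set Asymptotics

section Calculus

/-- The Beta integral on `[0, a]`, with real exponents. -/
theorem integral_rpow_mul_sub_rpow {u v a : ℝ} (hu : -1 < u) (hv : -1 < v) (ha : 0 < a) :
    ∫ x in (0 : ℝ)..a, x ^ u * (a - x) ^ v =
      a ^ (u + v + 1) * (Real.Gamma (u + 1) * Real.Gamma (v + 1) / Real.Gamma (u + v + 2)) := by
  have h := Complex.betaIntegral_scaled ((u : ℂ) + 1) ((v : ℂ) + 1) ha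
  rw [Complex.betaIntegral_eq_Gamma_mul_div _ _ (by simp; linarith) (by simp; linarith)] at h
  apply Complex.ofReal_injective
  rw [← intervalIntegral.integral_ofReal]
  convert! h using 1
  · refine intervalIntegral.integral_congr fun x hx => ?_
    rw [uIcc_of_le ha.le] at hx
    simp only [add_sub_cancel_right]
    rw [Complex.ofReal_mul, Complex.ofReal_cpow hx.1, Complex.ofReal_cpow (by linarith [hx.2])]
    push_cast
    rfl
  · rw [Complex.ofReal_mul, Complex.ofReal_cpow ha.le, Complex.ofReal_div, Complex.ofReal_mul,
      ← Complex.Gamma_ofReal, ← Complex.Gamma_ofReal, ← Complex.Gamma_ofReal]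
    push_cast
    ring_nf

theorem intervalIntegrable_rpow_mul_one_sub_rpow {u v : ℝ} (hu : -1 < u) (hv : -1 < v) :
    IntervalIntegrable (fun x : ℝ => x ^ u * (1 - x) ^ v) volume 0 1 := by
  have h := (Complex.betaIntegral_convergent (u := (u : ℂ) + 1) (v := (v : ℂ) + 1)
    (by simp; linarith) (by simp; linarith)).norm
  refine h.congr fun x hx => ?_
  rw [uIoc_of_le zero_le_one] at hx
  simp only [add_sub_cancel_right]
  rw [norm_mul, ← Complex.ofReal_one, ← Complex.ofReal_sub, ← Complex.ofReal_cpow hx.1.le,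
    ← Complex.ofReal_cpow (by linarith [hx.2]), Complex.norm_real, Complex.norm_real,
    Real.norm_of_nonneg (rpow_nonneg hx.1.le _),
    Real.norm_of_nonneg (rpow_nonneg (by linarith [hx.2]) _)]

/-- Truncated convolution products are integrable on the plane. -/
theorem integrable_indicator_convolution {φ ψ : ℝ → ℝ} {A B : Set ℝ} (hA : MeasurableSet A)
    (hB : MeasurableSet B) (hψ : IntegrableOn ψ A) (hφ : IntegrableOn φ B) :
    Integrable (fun p : ℝ × ℝ => A.indicator ψ p.2 * B.indicator φ (p.1 - p.2))
      (volume.prod volume) :=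
  ((integrable_indicator_iff hA).2 hψ).convolution_integrand (ContinuousLinearMap.mul ℝ ℝ)
    ((integrable_indicator_iff hB).2 hφ)

theorem integral_mul_primitive_comp_sub {φ ψ : ℝ → ℝ} {t : ℝ} (ht : 0 ≤ t)
    (hψ : IntervalIntegrable ψ volume 0 t) (hφ : IntervalIntegrable φ volume 0 t) :
    ∫ z in (0 : ℝ)..t, ψ z * ∫ x in (0 : ℝ)..(t - z), φ x =
      ∫ s in (0 : ℝ)..t, ∫ z in (0 : ℝ)..s, ψ z * φ (s - z) := by
  have key : ∀ s ∈ Ioc 0 t, ∀ z, (Ioc 0 s).indicator (fun z => ψ z * φ (s - z)) z =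
      (Ioc 0 t).indicator ψ z * (Ico 0 t).indicator φ (s - z) := by
    intro s hs z
    by_cases hz : z ∈ Ioc 0 s
    · rw [indicator_of_mem hz, indicator_of_mem (show z ∈ Ioc 0 t from ⟨hz.1, hz.2.trans hs.2⟩),
        indicator_of_mem (show s - z ∈ Ico 0 t from
          ⟨by linarith [hz.2], by linarith [hz.1, hs.2]⟩)]
    · rw [indicator_of_notMem hz]
      by_cases h0 : 0 < z
      · rw [indicator_of_notMem (show s - z ∉ Ico 0 t from fun h => hz ⟨h0, by linarith [h.1]⟩),
          mul_zero]
      · rw [indicator_of_notMem (show z ∉ Ioc 0 t from fun h => h0 h.1), zero_mul]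
  have hint := integrable_indicator_convolution (measurableSet_Ioc (a := (0 : ℝ)) (b := t))
    (measurableSet_Ico (a := (0 : ℝ)) (b := t))
    ((intervalIntegrable_iff_integrableOn_Ioc_of_le ht).1 hψ)
    ((intervalIntegrable_iff_integrableOn_Ico_of_le ht).1 hφ)
  have hint' : Integrable (Function.uncurry fun s z : ℝ =>
      (Ioc 0 t).indicator ψ z * (Ico 0 t).indicator φ (s - z))
      ((volume.restrict (uIoc 0 t)).prod volume) := by
    rw [← Measure.restrict_univ (μ := (volume : Measure ℝ)), Measure.restrict_restrict
      measurableSet_uIoc, Measure.prod_restrict]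
    exact hint.integrableOn
  have hR : ∫ s in (0 : ℝ)..t, ∫ z in (0 : ℝ)..s, ψ z * φ (s - z) =
      ∫ s in (0 : ℝ)..t, ∫ z, (Ioc 0 t).indicator ψ z * (Ico 0 t).indicator φ (s - z) := by
    refine intervalIntegral.integral_congr_ae (Eventually.of_forall fun s hs => ?_)
    rw [uIoc_of_le ht] at hs
    rw [intervalIntegral.integral_of_le hs.1.le,
      ← MeasureTheory.integral_indicator measurableSet_Ioc]
    exact integral_congr_ae (Eventually.of_forall fun z => key s hs z)
  rw [hR, intervalIntegral_integral_swap hint', intervalIntegral.integral_of_le ht,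
    ← MeasureTheory.integral_indicator measurableSet_Ioc]
  refine integral_congr_ae (Eventually.of_forall fun z => ?_)
  beta_reduce
  by_cases hz : z ∈ Ioc 0 t
  · rw [indicator_of_mem hz, indicator_of_mem hz, intervalIntegral.integral_const_mul,
      intervalIntegral.integral_comp_sub_right (fun x => (Ico 0 t).indicator φ x)]
    congr 1
    rw [intervalIntegral.integral_of_le (by linarith [hz.2]),
      intervalIntegral.integral_of_le (by linarith [hz.1] : 0 - z ≤ t - z),
      ← integral_Ico_eq_integral_Ioc, ← integral_Ico_eq_integral_Ioc,
      setIntegral_indicator measurableSet_Ico]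
    congr 2
    ext x
    simp only [mem_inter_iff, mem_Ico]
    constructor
    · rintro ⟨h1, h2⟩
      exact ⟨⟨by linarith [hz.1], h2⟩, h1, by linarith [hz.1]⟩
    · rintro ⟨⟨_, h2⟩, h1, _⟩
      exact ⟨h1, h2⟩
  · rw [indicator_of_notMem hz]
    simp [indicator_of_notMem hz]

/-- Two functions on `(0, ∞)` with the same derivative and the same limit `0` at `0` agree. -/
theorem eqOn_Ioi_of_hasDerivAt_of_tendsto {F G f : ℝ → ℝ}
    (hF : ∀ t, 0 < t → HasDerivAt F (f t) t) (hG : ∀ t, 0 < t → HasDerivAt G (f t) t)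
    (hF0 : Tendsto F (𝓝[>] 0) (𝓝 0)) (hG0 : Tendsto G (𝓝[>] 0) (𝓝 0)) {t : ℝ} (ht : 0 < t) :
    F t = G t := by
  have h := intervalIntegral.integral_eq_sub_of_hasDerivAt_of_tendsto (f := fun x => F x - G x)
    (f' := fun _ => 0) (fa := 0) (fb := F t - G t) ht
    (fun x hx => by simpa using (hF x hx.1).fun_sub (hG x hx.1)) (by simp)
    (by simpa using hF0.sub hG0)
    (((hF t ht).continuousAt.sub (hG t ht).continuousAt).tendsto.mono_left nhdsWithin_le_nhds)
  simp only [intervalIntegral.integral_zero, sub_zero] at h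
  linarith

/-- If `u' + u = O(t ^ a)` at infinity, then `u = O(t ^ a)`. -/
theorem isBigO_rpow_of_hasDerivAt_add {u r : ℝ → ℝ} {a : ℝ}
    (hu : ∀ t, 0 < t → HasDerivAt u (r t - u t) t) (hr : r =O[atTop] fun t => t ^ a) :
    u =O[atTop] fun t => t ^ a := by
  obtain ⟨C, hC0, hC⟩ := hr.exists_nonneg
  obtain ⟨c, hc⟩ := (hC.bound.and (eventually_gt_atTop (2 * |a| + 1))).exists_forall_of_atTop
  have hcpos : ∀ t, c ≤ t → 2 * |a| + 1 < t := fun t ht => (hc t ht).2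
  have hpos : ∀ t, c ≤ t → 0 < t := fun t ht => by linarith [hcpos t ht, abs_nonneg a]
  set K := max (2 * C) (|u c| / c ^ a) with hK
  have hcc := hpos c le_rfl
  have hca : 0 < c ^ a := rpow_pos_of_pos hcc _
  have hK0 : 0 ≤ K := le_max_of_le_left (by positivity)
  refine IsBigO.of_bound K (eventually_atTop.2 ⟨c, fun t ht => ?_⟩)
  have hd : ∀ x ∈ Icc c t, HasDerivAt (fun x => Real.exp x * u x) (Real.exp x * r x) x := by
    intro x hx
    convert! (Real.hasDerivAt_exp x).mul (hu x (hpos x hx.1)) using 1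
    ring
  have hB : ∀ x ∈ Icc c t, HasDerivAt (fun x => K * (Real.exp x * x ^ a))
      (K * (Real.exp x * x ^ a + Real.exp x * (a * x ^ (a - 1)))) x := fun x hx =>
    ((Real.hasDerivAt_exp x).mul (Real.hasDerivAt_rpow_const
      (Or.inl (hpos x hx.1).ne'))).const_mul K
  have h := image_norm_le_of_norm_deriv_right_le_deriv_boundary' (f := fun x => Real.exp x * u x)
    (f' := fun x => Real.exp x * r x) (a := c) (b := t)
    (fun x hx => (hd x hx).continuousAt.continuousWithinAt)
    (fun x hx => (hd x ⟨hx.1, hx.2.le⟩).hasDerivWithinAt)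
    (B := fun x => K * (Real.exp x * x ^ a)) ?_
    (fun x hx => (hB x hx).continuousAt.continuousWithinAt)
    (fun x hx => (hB x ⟨hx.1, hx.2.le⟩).hasDerivWithinAt) ?_ ⟨ht, le_rfl⟩
  · simp only [norm_mul, Real.norm_eq_abs, Real.abs_exp] at h
    rw [Real.norm_eq_abs, Real.norm_of_nonneg (rpow_nonneg (hpos t ht).le _)]
    have := Real.exp_pos t
    nlinarith
  · simp only [norm_mul, Real.norm_eq_abs, Real.abs_exp]
    have h1 : |u c| ≤ K * c ^ a := by
      rw [← div_le_iff₀ hca]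
      exact le_max_right _ _
    have := Real.exp_pos c
    nlinarith
  · intro x hx
    have hxp := hpos x hx.1
    have h1 := (hc x hx.1).1
    have h2 := hcpos x hx.1
    have hxa : 0 < x ^ a := rpow_pos_of_pos hxp _
    rw [Real.norm_of_nonneg hxa.le] at h1
    have h3 : -(1 / 2) * x ^ a ≤ a * x ^ (a - 1) := by
      rw [rpow_sub_one hxp.ne', ← mul_div_assoc, le_div_iff₀ hxp]
      nlinarith [neg_abs_le a]
    have h4 : ‖r x‖ ≤ K * (x ^ a / 2) := h1.trans (by
      have : 2 * C ≤ K := le_max_left _ _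
      nlinarith)
    have he := Real.exp_pos x
    rw [norm_mul, Real.norm_eq_abs (Real.exp x), Real.abs_exp]
    calc Real.exp x * ‖r x‖ ≤ Real.exp x * (K * (x ^ a / 2)) := by gcongr
      _ = K * (Real.exp x * (x ^ a + -(1 / 2) * x ^ a)) := by ring
      _ ≤ K * (Real.exp x * (x ^ a + a * x ^ (a - 1))) := by gcongr
      _ = _ := by ring

end Calculus

section Reduction

/-- The incomplete Gamma integral `∫₀ᵗ x ^ β e⁻ˣ dx`. -/
noncomputable def incGamma (β t : ℝ) : ℝ := ∫ x in (0 : ℝ)..t, x ^ β * Real.exp (-x)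

/-- The convolution `∫₀ᵗ e^{-(t - s)} s ^ β ds`. -/
noncomputable def expConv (β t : ℝ) : ℝ :=
  Real.exp (-t) * ∫ s in (0 : ℝ)..t, s ^ β * Real.exp s

theorem intervalIntegrable_rpow_mul_exp_neg {β : ℝ} (hβ : -1 < β) (a b : ℝ) :
    IntervalIntegrable (fun x : ℝ => x ^ β * Real.exp (-x)) volume a b :=
  (intervalIntegral.intervalIntegrable_rpow' hβ).mul_continuousOn (by fun_prop)

theorem intervalIntegrable_rpow_mul_exp {β : ℝ} (hβ : -1 < β) (a b : ℝ) :
    IntervalIntegrable (fun x : ℝ => x ^ β * Real.exp x) volume a b :=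
  (intervalIntegral.intervalIntegrable_rpow' hβ).mul_continuousOn (by fun_prop)

theorem continuous_incGamma {β : ℝ} (hβ : -1 < β) : Continuous (incGamma β) :=
  intervalIntegral.continuous_primitive (intervalIntegrable_rpow_mul_exp_neg hβ) 0

theorem continuous_expConv {β : ℝ} (hβ : -1 < β) : Continuous (expConv β) :=
  (by fun_prop : Continuous fun t : ℝ => Real.exp (-t)).mul
    (intervalIntegral.continuous_primitive (intervalIntegrable_rpow_mul_exp hβ) 0)

theorem hasDerivAt_incGamma {β : ℝ} (hβ : -1 < β) {t : ℝ} (ht : 0 < t) :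
    HasDerivAt (incGamma β) (t ^ β * Real.exp (-t)) t := by
  have hc : ContinuousAt (fun x : ℝ => x ^ β * Real.exp (-x)) t :=
    (Real.continuousAt_rpow_const _ _ (Or.inl ht.ne')).mul (by fun_prop)
  exact intervalIntegral.integral_hasDerivAt_right (intervalIntegrable_rpow_mul_exp_neg hβ 0 t)
    ((by fun_prop : Measurable fun x : ℝ => x ^ β * Real.exp (-x)).stronglyMeasurable
      |>.stronglyMeasurableAtFilter) hc

theorem hasDerivAt_expConv {β : ℝ} (hβ : -1 < β) {t : ℝ} (ht : 0 < t) :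
    HasDerivAt (expConv β) (t ^ β - expConv β t) t := by
  have hc : ContinuousAt (fun x : ℝ => x ^ β * Real.exp x) t :=
    (Real.continuousAt_rpow_const _ _ (Or.inl ht.ne')).mul (by fun_prop)
  have h := intervalIntegral.integral_hasDerivAt_right (intervalIntegrable_rpow_mul_exp hβ 0 t)
    ((by fun_prop : Measurable fun x : ℝ => x ^ β * Real.exp x).stronglyMeasurable
      |>.stronglyMeasurableAtFilter) hc
  convert! (hasDerivAt_neg t).exp.mul h using 1
  have : Real.exp (-t) * Real.exp t = 1 := by rw [← Real.exp_add]; simp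
  rw [expConv]
  linear_combination -t ^ β * this

/-- The odd kernel `|u| ^ β sgn u`. -/
noncomputable def oddRpow (β u : ℝ) : ℝ := |u| ^ β * Real.sign u

theorem measurable_sign : Measurable Real.sign :=
  Measurable.ite (measurableSet_lt measurable_id measurable_const) measurable_const
    (Measurable.ite (measurableSet_lt measurable_const measurable_id) measurable_const
      measurable_const)

theorem abs_sign_le_one (u : ℝ) : |Real.sign u| ≤ 1 := by
  rcases Real.sign_apply_eq u with h | h | h <;> simp [h]

theorem intervalIntegrable_oddRpow {β : ℝ} (hβ : -1 < β) {t : ℝ} (ht : 0 ≤ t) :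
    IntervalIntegrable (oddRpow β) volume (-t) t := by
  have h1 : IntervalIntegrable (fun u : ℝ => u ^ β) volume 0 t :=
    intervalIntegral.intervalIntegrable_rpow' hβ
  have h2 : IntervalIntegrable (fun u : ℝ => (-u) ^ β) volume (-t) 0 := by
    rw [← neg_zero, IntervalIntegrable.iff_comp_neg]
    simpa using h1.symm
  refine IntervalIntegrable.trans (b := 0) (h2.neg.congr_uIoo fun x hx => ?_)
    (h1.congr_uIoo fun x hx => ?_)
  · rw [uIoo_of_le (by linarith)] at hx
    simp [oddRpow, abs_of_neg hx.2, Real.sign_of_neg hx.2]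
  · rw [uIoo_of_le ht] at hx
    simp [oddRpow, abs_of_pos hx.1, Real.sign_of_pos hx.1]

theorem integral_eq_add_of_eqOn_Ioo {f g₁ g₂ : ℝ → ℝ} {a b c : ℝ} (hab : a ≤ b) (hbc : b ≤ c)
    (h₁ : IntervalIntegrable g₁ volume a b) (h₂ : IntervalIntegrable g₂ volume b c)
    (e₁ : ∀ x ∈ Ioo a b, g₁ x = f x) (e₂ : ∀ x ∈ Ioo b c, g₂ x = f x) :
    ∫ x in a..c, f x = (∫ x in a..b, g₁ x) + ∫ x in b..c, g₂ x := by
  have e₁' : EqOn g₁ f (uIoo a b) := by rwa [uIoo_of_le hab]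
  have e₂' : EqOn g₂ f (uIoo b c) := by rwa [uIoo_of_le hbc]
  rw [← intervalIntegral.integral_add_adjacent_intervals (h₁.congr_uIoo e₁') (h₂.congr_uIoo e₂'),
    intervalIntegral.integral_congr_uIoo e₁', intervalIntegral.integral_congr_uIoo e₂']

theorem integral_exp_mul_oddRpow {β : ℝ} (hβ : -1 < β) {s t : ℝ} (hs : s ∈ Icc 0 t) :
    ∫ x in (0 : ℝ)..t, Real.exp x * oddRpow β (x - s) =
      Real.exp t * expConv β (t - s) - Real.exp s * incGamma β s := by
  have hi1 : IntervalIntegrable (fun x : ℝ => Real.exp s * -(x ^ β * Real.exp (-x))) volume 0 s :=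
    (intervalIntegrable_rpow_mul_exp_neg hβ 0 s).neg.const_mul _
  have hi2 : IntervalIntegrable (fun x : ℝ => Real.exp s * (x ^ β * Real.exp x)) volume
    0 (t - s) := (intervalIntegrable_rpow_mul_exp hβ 0 (t - s)).const_mul _
  have hj1 := (hi1.comp_sub_left s).symm
  have hj2 := hi2.comp_sub_right s
  simp only [sub_zero, sub_self, zero_add, sub_add_cancel] at hj1 hj2
  rw [integral_eq_add_of_eqOn_Ioo hs.1 hs.2 hj1 hj2 ?_ ?_,
    intervalIntegral.integral_comp_sub_left (fun x => Real.exp s * -(x ^ β * Real.exp (-x))),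
    intervalIntegral.integral_comp_sub_right (fun x => Real.exp s * (x ^ β * Real.exp x)),
    intervalIntegral.integral_const_mul, intervalIntegral.integral_const_mul,
    intervalIntegral.integral_neg, expConv, incGamma, ← mul_assoc, ← Real.exp_add]
  · simp only [sub_zero, sub_self]
    ring_nf
  · intro x hx
    have : x - s < 0 := by linarith [hx.2]
    rw [oddRpow, abs_of_neg this, Real.sign_of_neg this, neg_sub, neg_sub]
    have : Real.exp s * Real.exp (x - s) = Real.exp x := by rw [← Real.exp_add]; simp
    linear_combination -(s - x) ^ β * this
  · intro x hx
    have : 0 < x - s := by linarith [hx.1]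
    rw [oddRpow, abs_of_pos this, Real.sign_of_pos this]
    have : Real.exp s * Real.exp (x - s) = Real.exp x := by rw [← Real.exp_add]; simp
    linear_combination (x - s) ^ β * this

theorem integral_rpow_mul_exp_mul_sign {β : ℝ} (hβ : -1 < β) {s t : ℝ} (hs : s ∈ Icc 0 t) :
    ∫ x in (0 : ℝ)..t, (t - x) ^ β * (Real.exp (-|x - s|) * Real.sign (x - s)) =
      expConv β (t - s) - Real.exp (t - s) * (incGamma β t - incGamma β (t - s)) := by
  have hi1 : IntervalIntegrable (fun x : ℝ => Real.exp (t - s) * -(x ^ β * Real.exp (-x))) volume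
    (t - s) t := (intervalIntegrable_rpow_mul_exp_neg hβ _ _).neg.const_mul _
  have hi2 : IntervalIntegrable (fun x : ℝ => Real.exp (-(t - s)) * (x ^ β * Real.exp x)) volume
    0 (t - s) := (intervalIntegrable_rpow_mul_exp hβ 0 (t - s)).const_mul _
  have hj1 := (hi1.comp_sub_left t).symm
  have hj2 := (hi2.comp_sub_left t).symm
  simp only [sub_zero, sub_self, sub_sub_cancel] at hj1 hj2
  rw [integral_eq_add_of_eqOn_Ioo hs.1 hs.2 hj1 hj2 ?_ ?_,
    intervalIntegral.integral_comp_sub_left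
      (fun x => Real.exp (t - s) * -(x ^ β * Real.exp (-x))),
    intervalIntegral.integral_comp_sub_left (fun x => Real.exp (-(t - s)) * (x ^ β * Real.exp x)),
    intervalIntegral.integral_const_mul, intervalIntegral.integral_const_mul,
    intervalIntegral.integral_neg, expConv, incGamma, incGamma,
    intervalIntegral.integral_interval_sub_left (intervalIntegrable_rpow_mul_exp_neg hβ _ _)
      (intervalIntegrable_rpow_mul_exp_neg hβ _ _)]
  · simp only [sub_zero, sub_self]
    ring
  · intro x hx
    have : x - s < 0 := by linarith [hx.2]
    rw [abs_of_neg this, Real.sign_of_neg this]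
    have : Real.exp (t - s) * Real.exp (-(t - x)) = Real.exp (- -(x - s)) := by
      rw [← Real.exp_add]; ring_nf
    linear_combination -(t - x) ^ β * this
  · intro x hx
    have : 0 < x - s := by linarith [hx.1]
    rw [abs_of_pos this, Real.sign_of_pos this]
    have : Real.exp (-(t - s)) * Real.exp (t - x) = Real.exp (-(x - s)) := by
      rw [← Real.exp_add]; ring_nf
    linear_combination (t - x) ^ β * this

theorem integrableOn_oddRpow_sub {β : ℝ} (hβ : -1 < β) (t : ℝ) :
    IntegrableOn (fun p : ℝ × ℝ => oddRpow β (p.1 - p.2)) (Ioc 0 t ×ˢ Ioc 0 t) := by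
  have h := integrable_indicator_convolution (ψ := fun _ => 1) (φ := oddRpow β)
    (measurableSet_Ioc (a := (0 : ℝ)) (b := t)) (measurableSet_Ioc (a := -|t|) (b := |t|))
    (by simp) ((intervalIntegrable_iff_integrableOn_Ioc_of_le (by simp)).1
      (intervalIntegrable_oddRpow hβ (abs_nonneg t)))
  refine (h.integrableOn (s := Ioc 0 t ×ˢ Ioc 0 t)).congr_fun (fun p hp => ?_)
    (measurableSet_Ioc.prod measurableSet_Ioc)
  obtain ⟨h1, h2⟩ := hp
  have ht : 0 < t := h1.1.trans_le h1.2
  beta_reduce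
  rw [indicator_of_mem h2, abs_of_pos ht, one_mul]
  by_cases h3 : p.1 - p.2 ∈ Ioc (-t) t
  · rw [indicator_of_mem h3]
  · exact absurd ⟨by linarith [h1.1, h2.2], by linarith [h1.2, h2.1]⟩ h3

theorem measurable_exp_mul_sign : Measurable fun u : ℝ => Real.exp (-|u|) * Real.sign u :=
  (by fun_prop : Measurable fun u : ℝ => Real.exp (-|u|)).mul measurable_sign

theorem norm_exp_mul_sign_le_one (u : ℝ) : ‖Real.exp (-|u|) * Real.sign u‖ ≤ 1 := by
  rw [norm_mul, Real.norm_eq_abs, Real.abs_exp]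
  exact mul_le_one₀ (Real.exp_le_one_iff.2 (by simp)) (norm_nonneg _) (abs_sign_le_one u)

/-- The inner triple integral of `L1` as a single integral of a product of one-variable
functions. -/
theorem triple_integral_eq {β : ℝ} (hβ : -1 < β) {t : ℝ} (ht : 0 < t) :
    Real.exp (-t) *
      ∫ t₂ in (0:ℝ)..t, ∫ s₁ in (0:ℝ)..t, ∫ s₂ in (0:ℝ)..t,
        Real.exp (s₁ - |t₂ - s₂|) * (t - t₂) ^ β * |s₁ - s₂| ^ β *
          Real.sign (t₂ - s₂) * Real.sign (s₁ - s₂) =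
      ∫ z in (0 : ℝ)..t, (expConv β z - Real.exp z * (incGamma β t - incGamma β z)) *
        (expConv β z - Real.exp (-z) * incGamma β (t - z)) := by
  set B : ℝ → ℝ := fun s => Real.exp t * expConv β (t - s) - Real.exp s * incGamma β s with hB
  have hBc : Continuous B := by
    have := continuous_incGamma hβ
    have := continuous_expConv hβ
    fun_prop
  have hinner : ∀ t₂ : ℝ, ∫ s₁ in (0:ℝ)..t, ∫ s₂ in (0:ℝ)..t,
        Real.exp (s₁ - |t₂ - s₂|) * (t - t₂) ^ β * |s₁ - s₂| ^ β *
          Real.sign (t₂ - s₂) * Real.sign (s₁ - s₂) =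
      ∫ s₂ in (0:ℝ)..t, (Real.exp (-|t₂ - s₂|) * Real.sign (t₂ - s₂)) * ((t - t₂) ^ β * B s₂) := by
    intro t₂
    rw [intervalIntegral_intervalIntegral_swap]
    · refine intervalIntegral.integral_congr fun s₂ hs₂ => ?_
      rw [uIcc_of_le ht.le] at hs₂
      rw [show B s₂ = _ from (integral_exp_mul_oddRpow hβ hs₂).symm,
        ← intervalIntegral.integral_const_mul,
        ← intervalIntegral.integral_const_mul]
      refine intervalIntegral.integral_congr fun s₁ _ => ?_
      rw [oddRpow, sub_eq_add_neg s₁ |_|, Real.exp_add]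
      ring
    · rw [uIoc_of_le ht.le]
      have h := (integrableOn_oddRpow_sub hβ t).integrable.bdd_mul
        (c := Real.exp t * |(t - t₂) ^ β|)
        (f := fun p : ℝ × ℝ => Real.exp p.1 * (Real.exp (-|t₂ - p.2|) * Real.sign (t₂ - p.2)) *
          (t - t₂) ^ β) ?_ ?_
      · refine h.congr (Eventually.of_forall fun p => ?_)
        simp only [Function.uncurry, oddRpow]
        rw [sub_eq_add_neg p.1 |_|, Real.exp_add]
        ring
      · have := measurable_exp_mul_sign.comp (measurable_snd.const_sub t₂ : Measurable
          fun p : ℝ × ℝ => t₂ - p.2)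
        exact (((Real.measurable_exp.comp measurable_fst).mul this).mul_const
          _).aestronglyMeasurable
      · refine (ae_restrict_iff' (measurableSet_Ioc.prod measurableSet_Ioc)).2
          (Eventually.of_forall fun p hp => ?_)
        rw [norm_mul, norm_mul, Real.norm_eq_abs (Real.exp _), Real.abs_exp]
        have h1 := norm_exp_mul_sign_le_one (t₂ - p.2)
        have h2 : Real.exp p.1 ≤ Real.exp t := Real.exp_le_exp.2 hp.1.2
        rw [Real.norm_eq_abs ((t - t₂) ^ β)]
        gcongr
        calc Real.exp p.1 * _ ≤ Real.exp t * 1 := by gcongr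
          _ = _ := mul_one _
  simp_rw [hinner]
  rw [intervalIntegral_intervalIntegral_swap, ← intervalIntegral.integral_const_mul]
  · have h : ∀ s ∈ uIcc 0 t, Real.exp (-t) * ∫ t₂ in (0 : ℝ)..t,
        (Real.exp (-|t₂ - s|) * Real.sign (t₂ - s)) * ((t - t₂) ^ β * B s) =
        (fun z => (expConv β z - Real.exp z * (incGamma β t - incGamma β z)) *
        (expConv β z - Real.exp (-z) * incGamma β (t - z))) (t - s) := by
      intro s hs
      rw [uIcc_of_le ht.le] at hs
      beta_reduce
      rw [← integral_rpow_mul_exp_mul_sign hβ hs, ← intervalIntegral.integral_const_mul,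
        ← intervalIntegral.integral_mul_const]
      refine intervalIntegral.integral_congr fun x _ => ?_
      rw [hB, sub_sub_cancel, neg_sub, sub_eq_add_neg s t, Real.exp_add]
      have : Real.exp (-t) * Real.exp t = 1 := by rw [← Real.exp_add]; simp
      linear_combination (t - x) ^ β * (Real.exp (-|x - s|) * Real.sign (x - s)) *
        expConv β (t - s) * this
    rw [intervalIntegral.integral_congr h, intervalIntegral.integral_comp_sub_left
      (fun z => (expConv β z - Real.exp z * (incGamma β t - incGamma β z)) *
        (expConv β z - Real.exp (-z) * incGamma β (t - z)))]
    simp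
  · have h1 : IntegrableOn (fun x : ℝ => (t - x) ^ β) (Ioc 0 t) := by
      have := ((intervalIntegral.intervalIntegrable_rpow' hβ :
        IntervalIntegrable (fun x : ℝ => x ^ β) volume 0 t).comp_sub_left t).symm
      simp only [sub_zero, sub_self] at this
      exact (intervalIntegrable_iff_integrableOn_Ioc_of_le ht.le).1 this
    have h2 : IntegrableOn B (Ioc 0 t) :=
      (intervalIntegrable_iff_integrableOn_Ioc_of_le ht.le).1 (hBc.intervalIntegrable _ _)
    rw [uIoc_of_le ht.le, IntegrableOn, Measure.volume_eq_prod, ← Measure.prod_restrict]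
    exact (h1.integrable.mul_prod h2.integrable).bdd_mul (c := 1)
      (measurable_exp_mul_sign.comp (measurable_fst.sub measurable_snd)).aestronglyMeasurable
      (Eventually.of_forall fun p => norm_exp_mul_sign_le_one _)

end Reduction

section Convolution

theorem intervalIntegrable_rpow_mul_exp_mul {β : ℝ} (hβ : -1 < β) (k a b : ℝ) :
    IntervalIntegrable (fun x : ℝ => x ^ β * Real.exp (k * x)) volume a b :=
  (intervalIntegral.intervalIntegrable_rpow' hβ).mul_continuousOn (by fun_prop)

/-- The Beta value `B(β + 1, β + 1)`. -/
noncomputable def betaConst (β : ℝ) : ℝ :=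
  Real.Gamma (β + 1) * Real.Gamma (β + 1) / Real.Gamma (2 * β + 2)

theorem integral_rpow_mul_exp_mul_primitive {β : ℝ} (hβ : -1 < β) (k : ℝ) {s : ℝ} (hs : 0 ≤ s) :
    ∫ z in (0 : ℝ)..s, z ^ β * Real.exp (k * z) *
        ∫ x in (0 : ℝ)..(s - z), x ^ β * Real.exp (k * x) =
      betaConst β * ∫ u in (0 : ℝ)..s, u ^ (2 * β + 1) * Real.exp (k * u) := by
  rw [integral_mul_primitive_comp_sub hs (intervalIntegrable_rpow_mul_exp_mul hβ k 0 s)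
    (intervalIntegrable_rpow_mul_exp_mul hβ k 0 s), ← intervalIntegral.integral_const_mul]
  refine intervalIntegral.integral_congr_ae (Eventually.of_forall fun u hu => ?_)
  rw [uIoc_of_le hs] at hu
  have h : ∀ z, z ^ β * Real.exp (k * z) * ((u - z) ^ β * Real.exp (k * (u - z))) =
      Real.exp (k * u) * (z ^ β * (u - z) ^ β) := by
    intro z
    have : Real.exp (k * z) * Real.exp (k * (u - z)) = Real.exp (k * u) := by
      rw [← Real.exp_add]; ring_nf
    linear_combination z ^ β * (u - z) ^ β * this
  simp_rw [h]
  rw [intervalIntegral.integral_const_mul, integral_rpow_mul_sub_rpow hβ hβ hu.1, betaConst,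
    show β + β + 1 = 2 * β + 1 by ring, show β + β + 2 = 2 * β + 2 by ring]
  ring

theorem integral_eq_integral_comp_sub (f : ℝ → ℝ) (s : ℝ) :
    ∫ z in (0 : ℝ)..s, f z = ∫ z in (0 : ℝ)..s, f (s - z) := by
  rw [intervalIntegral.integral_comp_sub_left]
  simp

theorem integral_rpow_mul_exp_neg_mul_incGamma {β : ℝ} (hβ : -1 < β) {s : ℝ} (hs : 0 ≤ s) :
    ∫ z in (0 : ℝ)..s, incGamma β z * ((s - z) ^ β * Real.exp (-(s - z))) =
      betaConst β * incGamma (2 * β + 1) s := by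
  have h := integral_rpow_mul_exp_mul_primitive hβ (-1) hs
  simp only [neg_one_mul] at h
  rw [incGamma, ← h]
  refine (integral_eq_integral_comp_sub _ s).trans ?_
  simp only [sub_sub_cancel, incGamma]
  simp_rw [mul_comm]

theorem integral_expConv_mul_rpow_mul_exp_neg {β : ℝ} (hβ : -1 < β) {s : ℝ} (hs : 0 ≤ s) :
    ∫ z in (0 : ℝ)..s, Real.exp (-z) * expConv β z * ((s - z) ^ β * Real.exp (-(s - z))) =
      betaConst β * (Real.exp (-s) * expConv (2 * β + 1) s) := by
  have h := integral_rpow_mul_exp_mul_primitive hβ 1 hs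
  simp only [one_mul] at h
  rw [expConv, mul_left_comm, mul_left_comm (betaConst β), ← h]
  refine (integral_eq_integral_comp_sub _ s).trans ?_
  simp only [sub_sub_cancel, expConv]
  rw [← intervalIntegral.integral_const_mul, ← intervalIntegral.integral_const_mul]
  refine intervalIntegral.integral_congr fun z _ => ?_
  have : Real.exp (-(s - z)) * Real.exp (-(s - z)) * Real.exp (-z) =
      Real.exp (-s) * Real.exp (-s) * Real.exp z := by
    simp only [← Real.exp_add]; ring_nf
  linear_combination (∫ s in 0..(s - z), s ^ β * Real.exp s) * z ^ β * this

theorem integral_incGamma_mul_incGamma_comp_sub {β : ℝ} (hβ : -1 < β) {t : ℝ} (ht : 0 ≤ t) :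
    ∫ z in (0 : ℝ)..t, incGamma β z * incGamma β (t - z) =
      betaConst β * ∫ s in (0 : ℝ)..t, incGamma (2 * β + 1) s := by
  have h := integral_mul_primitive_comp_sub ht ((continuous_incGamma hβ).intervalIntegrable 0 t)
    (intervalIntegrable_rpow_mul_exp_neg hβ 0 t)
  refine h.trans ?_
  rw [← intervalIntegral.integral_const_mul]
  refine intervalIntegral.integral_congr fun s hs => ?_
  rw [uIcc_of_le ht] at hs
  exact integral_rpow_mul_exp_neg_mul_incGamma hβ hs.1

theorem integral_expConv_mul_incGamma_comp_sub {β : ℝ} (hβ : -1 < β) {t : ℝ} (ht : 0 ≤ t) :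
    ∫ z in (0 : ℝ)..t, Real.exp (-z) * expConv β z * incGamma β (t - z) =
      betaConst β * ∫ s in (0 : ℝ)..t, Real.exp (-s) * expConv (2 * β + 1) s := by
  have hc := continuous_expConv hβ
  have h := integral_mul_primitive_comp_sub ht
    ((by fun_prop : Continuous fun z => Real.exp (-z) * expConv β z).intervalIntegrable 0 t)
    (intervalIntegrable_rpow_mul_exp_neg hβ 0 t)
  refine h.trans ?_
  rw [← intervalIntegral.integral_const_mul]
  refine intervalIntegral.integral_congr fun s hs => ?_
  rw [uIcc_of_le ht] at hs
  exact integral_expConv_mul_rpow_mul_exp_neg hβ hs.1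

theorem integral_sub_mul_sub_eq {β : ℝ} (hβ : -1 < β) {t : ℝ} (ht : 0 ≤ t) :
    ∫ z in (0 : ℝ)..t, (expConv β z - Real.exp z * (incGamma β t - incGamma β z)) *
        (expConv β z - Real.exp (-z) * incGamma β (t - z)) =
      ((∫ z in (0 : ℝ)..t, expConv β z ^ 2) +
        (∫ z in (0 : ℝ)..t, Real.exp z * incGamma β z * expConv β z) -
        incGamma β t * ∫ z in (0 : ℝ)..t, Real.exp z * expConv β z) +
      incGamma β t * (∫ z in (0 : ℝ)..t, incGamma β z) -
      betaConst β * (∫ s in (0 : ℝ)..t, incGamma (2 * β + 1) s) -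
      betaConst β * ∫ s in (0 : ℝ)..t, Real.exp (-s) * expConv (2 * β + 1) s := by
  have hc := continuous_expConv hβ
  have hg := continuous_incGamma hβ
  rw [← integral_incGamma_mul_incGamma_comp_sub hβ ht,
    ← integral_expConv_mul_incGamma_comp_sub hβ ht]
  have h1 : ∫ z in (0 : ℝ)..t, incGamma β z = ∫ z in (0 : ℝ)..t, incGamma β (t - z) :=
    integral_eq_integral_comp_sub _ _
  rw [h1, ← intervalIntegral.integral_const_mul, ← intervalIntegral.integral_const_mul,
    ← intervalIntegral.integral_add (by apply Continuous.intervalIntegrable; fun_prop)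
      (by apply Continuous.intervalIntegrable; fun_prop),
    ← intervalIntegral.integral_sub (by apply Continuous.intervalIntegrable; fun_prop)
      (by apply Continuous.intervalIntegrable; fun_prop),
    ← intervalIntegral.integral_add (by apply Continuous.intervalIntegrable; fun_prop)
      (by apply Continuous.intervalIntegrable; fun_prop),
    ← intervalIntegral.integral_sub (by apply Continuous.intervalIntegrable; fun_prop)
      (by apply Continuous.intervalIntegrable; fun_prop),
    ← intervalIntegral.integral_sub (by apply Continuous.intervalIntegrable; fun_prop)
      (by apply Continuous.intervalIntegrable; fun_prop)]
  refine intervalIntegral.integral_congr fun z _ => ?_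
  have : Real.exp z * Real.exp (-z) = 1 := by rw [← Real.exp_add]; simp
  linear_combination (incGamma β t - incGamma β z) * incGamma β (t - z) * this

end Convolution

section Moments

/-- The moments `∫₀¹ xⁿ e^{-t x} (1 - x) ^ β dx`. -/
noncomputable def expMoment (β : ℝ) (n : ℕ) (t : ℝ) : ℝ :=
  ∫ x in (0 : ℝ)..1, x ^ n * Real.exp (-(t * x)) * (1 - x) ^ β

/-- The first moment `∫₀ᵗ (t - s) e^{-(t - s)} s ^ β ds` in terms of `expConv`. -/
noncomputable def expConvOne (β t : ℝ) : ℝ := (t + 1 + β) * expConv β t - t * t ^ β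

/-- The second moment `∫₀ᵗ (t - s)² e^{-(t - s)} s ^ β ds` in terms of `expConv`. -/
noncomputable def expConvTwo (β t : ℝ) : ℝ := (2 + β + t) * expConvOne β t - t * expConv β t

theorem intervalIntegrable_one_sub_rpow {β : ℝ} (hβ : -1 < β) :
    IntervalIntegrable (fun x : ℝ => (1 - x) ^ β) volume 0 1 := by
  simpa using intervalIntegrable_rpow_mul_one_sub_rpow (u := 0) (by norm_num) hβ

theorem intervalIntegrable_expMoment {β : ℝ} (hβ : -1 < β) (n : ℕ) (t : ℝ) :
    IntervalIntegrable (fun x : ℝ => x ^ n * Real.exp (-(t * x)) * (1 - x) ^ β) volume 0 1 :=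
  (intervalIntegrable_one_sub_rpow hβ).continuousOn_mul (by fun_prop)

theorem expMoment_nonneg (β : ℝ) (n : ℕ) (t : ℝ) : 0 ≤ expMoment β n t :=
  intervalIntegral.integral_nonneg zero_le_one fun x hx => by
    have := rpow_nonneg (sub_nonneg.2 hx.2) β
    have := hx.1
    positivity

theorem expMoment_le {β : ℝ} (hβ : -1 < β) (n : ℕ) {t : ℝ} (ht : 0 ≤ t) :
    expMoment β n t ≤ expMoment β 0 0 := by
  refine intervalIntegral.integral_mono_on zero_le_one (intervalIntegrable_expMoment hβ n t)
    (intervalIntegrable_expMoment hβ 0 0) fun x hx => ?_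
  have := rpow_nonneg (sub_nonneg.2 hx.2) β
  have h1 : x ^ n ≤ x ^ 0 := pow_le_pow_of_le_one hx.1 hx.2 (Nat.zero_le n)
  have h2 : Real.exp (-(t * x)) ≤ Real.exp (-(0 * x)) := by
    gcongr
    · exact hx.1
  have := hx.1
  gcongr

theorem expMoment_recurrence {β : ℝ} (hβ : -1 < β) (n : ℕ) (t : ℝ) :
    t * expMoment β (n + 1) t = (β + 1 + n + t) * expMoment β n t -
      n * expMoment β (n - 1) t - if n = 0 then 1 else 0 := by
  have hd : ∀ x ∈ Ioo (0 : ℝ) 1, HasDerivAt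
      (fun x : ℝ => -(x ^ n * Real.exp (-(t * x)) * (1 - x) ^ (β + 1)))
      ((β + 1 + n + t) * (x ^ n * Real.exp (-(t * x)) * (1 - x) ^ β) -
        n * (x ^ (n - 1) * Real.exp (-(t * x)) * (1 - x) ^ β) -
        t * (x ^ (n + 1) * Real.exp (-(t * x)) * (1 - x) ^ β)) x := by
    intro x hx
    have hx1 : 0 < 1 - x := sub_pos.2 hx.2
    have h1 := ((hasDerivAt_id x).const_sub 1).rpow_const (p := β + 1) (Or.inl hx1.ne')
    have h2 := (((hasDerivAt_id x).const_mul t).fun_neg).exp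
    convert! (((hasDerivAt_pow n x).fun_mul h2).fun_mul h1).fun_neg using 1
    simp only [id, rpow_add_one hx1.ne', add_sub_cancel_right, mul_one]
    rcases n with _ | n
    · simp
      ring
    · push_cast
      simp only [pow_succ]
      ring
  have hi := fun n => intervalIntegrable_expMoment hβ n t
  have h := intervalIntegral.integral_eq_sub_of_hasDerivAt_of_le zero_le_one
    (f := fun x : ℝ => -(x ^ n * Real.exp (-(t * x)) * (1 - x) ^ (β + 1)))
    (ContinuousOn.neg (ContinuousOn.mul (by fun_prop)
      (ContinuousOn.rpow_const (by fun_prop) fun x _ => Or.inr (by linarith)))) hd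
    ((((hi n).const_mul _).sub ((hi (n - 1)).const_mul _)).sub ((hi (n + 1)).const_mul _))
  rw [intervalIntegral.integral_sub (((hi n).const_mul _).sub ((hi (n - 1)).const_mul _))
    ((hi (n + 1)).const_mul _), intervalIntegral.integral_sub ((hi n).const_mul _)
    ((hi (n - 1)).const_mul _)] at h
  simp only [intervalIntegral.integral_const_mul, sub_self, sub_zero, one_rpow,
    zero_rpow (show β + 1 ≠ 0 by linarith), mul_zero, neg_zero, Real.exp_zero, mul_one,
    zero_pow_eq, sub_neg_eq_add, zero_add] at h
  simp only [expMoment]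
  linarith

theorem expConv_eq {β : ℝ} {t : ℝ} (ht : 0 < t) : expConv β t = t * t ^ β * expMoment β 0 t := by
  have h1 := intervalIntegral.mul_integral_comp_mul_left (a := (0 : ℝ)) (b := 1)
    (f := fun s : ℝ => (t - s) ^ β * Real.exp (t - s)) t
  rw [mul_zero, mul_one, ← integral_eq_integral_comp_sub (fun s => s ^ β * Real.exp s)] at h1
  rw [expConv, ← h1, expMoment, mul_left_comm, mul_assoc,
    ← intervalIntegral.integral_const_mul (Real.exp (-t)),
    ← intervalIntegral.integral_const_mul (t ^ β)]
  congr 1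
  refine intervalIntegral.integral_congr fun x hx => ?_
  rw [uIcc_of_le zero_le_one] at hx
  have : t - t * x = t * (1 - x) := by ring
  rw [pow_zero, one_mul, sub_eq_add_neg t, Real.exp_add, ← sub_eq_add_neg, this,
    mul_rpow ht.le (sub_nonneg.2 hx.2)]
  have : Real.exp (-t) * Real.exp t = 1 := by rw [← Real.exp_add]; simp
  linear_combination t ^ β * (1 - x) ^ β * Real.exp (-(t * x)) * this

theorem expConvOne_eq {β : ℝ} (hβ : -1 < β) {t : ℝ} (ht : 0 < t) :
    expConvOne β t = t ^ 2 * t ^ β * expMoment β 1 t := by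
  have h := expMoment_recurrence hβ 0 t
  simp only [zero_add, Nat.cast_zero, add_zero, zero_mul, sub_zero, if_true] at h
  rw [expConvOne, expConv_eq ht]
  linear_combination -t * t ^ β * h

theorem expConvTwo_eq {β : ℝ} (hβ : -1 < β) {t : ℝ} (ht : 0 < t) :
    expConvTwo β t = t ^ 3 * t ^ β * expMoment β 2 t := by
  have h := expMoment_recurrence hβ 1 t
  simp only [Nat.reduceAdd, Nat.cast_one, one_mul, tsub_self, one_ne_zero, if_false, sub_zero] at h
  rw [expConvTwo, expConvOne_eq hβ ht, expConv_eq ht]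
  linear_combination -t ^ 2 * t ^ β * h

theorem hasDerivAt_rpow_self {β t : ℝ} (ht : 0 < t) :
    HasDerivAt (fun t : ℝ => t ^ β) (β * t ^ β / t) t := by
  have := Real.hasDerivAt_rpow_const (x := t) (p := β) (Or.inl ht.ne')
  rwa [rpow_sub_one ht.ne', ← mul_div_assoc] at this

theorem hasDerivAt_expConvOne {β : ℝ} (hβ : -1 < β) {t : ℝ} (ht : 0 < t) :
    HasDerivAt (expConvOne β) (expConv β t - expConvOne β t) t := by
  convert! ((((hasDerivAt_id t).add_const 1).add_const β).mul (hasDerivAt_expConv hβ ht)).sub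
    ((hasDerivAt_id t).mul (hasDerivAt_rpow_self (β := β) ht)) using 1
  simp only [expConvOne, id]
  field_simp
  ring

theorem hasDerivAt_expConvTwo {β : ℝ} (hβ : -1 < β) {t : ℝ} (ht : 0 < t) :
    HasDerivAt (expConvTwo β) (2 * expConvOne β t - expConvTwo β t) t := by
  convert! ((((hasDerivAt_id t).const_add (2 + β))).mul (hasDerivAt_expConvOne hβ ht)).sub
    ((hasDerivAt_id t).mul (hasDerivAt_expConv hβ ht)) using 1
  simp only [expConvTwo, expConvOne, id]
  ring

end Moments

section FirstAntiderivative

theorem rpow_two_mul_add_one {t : ℝ} (ht : 0 < t) (β : ℝ) :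
    t ^ (2 * β + 1) = t * t ^ β * t ^ β := by
  rw [rpow_add_one ht.ne', two_mul, rpow_add ht]
  ring

theorem tendsto_primitive_nhdsGT {f : ℝ → ℝ} (hf : IntervalIntegrable f volume 0 1) :
    Tendsto (fun t => ∫ x in (0 : ℝ)..t, f x) (𝓝[>] 0) (𝓝 0) := by
  have h := intervalIntegral.continuousOn_primitive_interval (a := 0) (b := 1)
    ((intervalIntegrable_iff' (by simp)).1 hf)
  have h0 := h 0 (by simp)
  rw [ContinuousWithinAt, intervalIntegral.integral_same, uIcc_of_le zero_le_one] at h0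
  rw [← nhdsWithin_Ioo_eq_nhdsGT (zero_lt_one' ℝ)]
  exact h0.mono_left (nhdsWithin_mono _ Ioo_subset_Icc_self)

theorem _root_.Continuous.hasDerivAt_primitive {f : ℝ → ℝ} (hf : Continuous f) (t : ℝ) :
    HasDerivAt (fun t => ∫ z in (0 : ℝ)..t, f z) (f t) t :=
  intervalIntegral.integral_hasDerivAt_right (hf.intervalIntegrable 0 t)
    (hf.stronglyMeasurableAtFilter _ _) hf.continuousAt

theorem _root_.Continuous.primitive {f : ℝ → ℝ} (hf : Continuous f) :
    Continuous (fun t => ∫ z in (0 : ℝ)..t, f z) :=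
  continuous_iff_continuousAt.2 fun t => (hf.hasDerivAt_primitive t).continuousAt

theorem _root_.Continuous.tendsto_nhdsGT_zero {f : ℝ → ℝ} (hf : Continuous f) (h0 : f 0 = 0) :
    Tendsto f (𝓝[>] 0) (𝓝 0) :=
  (hf.tendsto' 0 0 h0).mono_left nhdsWithin_le_nhds

theorem integral_Ioi_expMoment_integrand {β : ℝ} (hβ : -1 < β) {x : ℝ} (hx : 0 < x) :
    ∫ t in Ioi (0 : ℝ), t ^ (2 * β + 1) * (x ^ 2 * Real.exp (-(t * x)) * (1 - x) ^ β) =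
      Real.Gamma (2 * β + 2) * (x ^ (-(2 * β)) * (1 - x) ^ β) := by
  have h1 := Real.integral_rpow_mul_exp_neg_mul_Ioi (a := 2 * β + 2) (r := x) (by linarith) hx
  have h2 : ∫ t in Ioi (0 : ℝ), t ^ (2 * β + 1) * (x ^ 2 * Real.exp (-(t * x)) * (1 - x) ^ β) =
      ∫ t in Ioi (0 : ℝ), (x ^ 2 * (1 - x) ^ β) *
        (t ^ (2 * β + 2 - 1) * Real.exp (-(x * t))) := by
    refine integral_congr_ae (Eventually.of_forall fun t => ?_)
    dsimp only
    rw [mul_comm x t, show 2 * β + 2 - 1 = 2 * β + 1 by ring]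
    ring
  have h3 : x ^ (-(2 * β)) = x ^ ((2 : ℕ) : ℝ) * x ^ (-(2 * β + 2)) := by
    rw [← rpow_add hx]
    congr 1
    push_cast
    ring
  rw [h2, MeasureTheory.integral_const_mul, h1, h3, one_div, inv_rpow hx.le, ← rpow_neg hx.le,
    rpow_natCast]
  ring

theorem integrable_rpow_mul_expMoment_integrand {β : ℝ} (hβ : -1 < β) (hβ' : β < 1 / 2) :
    Integrable (fun p : ℝ × ℝ =>
      p.1 ^ (2 * β + 1) * (p.2 ^ 2 * Real.exp (-(p.1 * p.2)) * (1 - p.2) ^ β))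
      ((volume.restrict (Ioi 0)).prod (volume.restrict (Ioc 0 1))) := by
  have hm : Measurable (fun p : ℝ × ℝ =>
      p.1 ^ (2 * β + 1) * (p.2 ^ 2 * Real.exp (-(p.1 * p.2)) * (1 - p.2) ^ β)) := by fun_prop
  rw [integrable_prod_iff' hm.aestronglyMeasurable]
  have hx : ∀ x : ℝ, 0 < x → IntegrableOn (fun t : ℝ => t ^ (2 * β + 1) * Real.exp (-(x * t)))
      (Ioi 0) := by
    intro x hx
    have := integrableOn_rpow_mul_exp_neg_mul_rpow (s := 2 * β + 1) (p := 1) (b := x)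
      (by linarith) one_pos hx
    simpa using this
  constructor
  · refine (ae_restrict_iff' measurableSet_Ioc).2 (Eventually.of_forall fun x hx' => ?_)
    refine ((hx x hx'.1).integrable.mul_const (x ^ 2 * (1 - x) ^ β)).congr
      (Eventually.of_forall fun t => ?_)
    beta_reduce
    rw [mul_comm x t]
    ring
  · have h := (intervalIntegrable_iff_integrableOn_Ioc_of_le zero_le_one).1
      (intervalIntegrable_rpow_mul_one_sub_rpow (u := -(2 * β)) (by linarith) hβ)
    refine (h.const_mul (Real.Gamma (2 * β + 2))).congr
      ((ae_restrict_iff' measurableSet_Ioc).2 (Eventually.of_forall fun x hx' => ?_))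
    refine (integral_Ioi_expMoment_integrand hβ hx'.1).symm.trans ?_
    refine setIntegral_congr_fun measurableSet_Ioi fun t ht => ?_
    have ht' : 0 < t := ht
    have := rpow_nonneg (sub_nonneg.2 hx'.2) β
    exact (Real.norm_of_nonneg (by positivity)).symm

/-- The primitive `∫₀ᵀ t ^ (2 β + 1) ∫₀¹ x² e^{-t x} (1 - x) ^ β dx dt`. -/
noncomputable def momentPrimitive (β T : ℝ) : ℝ :=
  ∫ t in (0 : ℝ)..T, t ^ (2 * β + 1) * expMoment β 2 t

theorem integrableOn_rpow_mul_expMoment {β : ℝ} (hβ : -1 < β) (hβ' : β < 1 / 2) :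
    IntegrableOn (fun t => t ^ (2 * β + 1) * expMoment β 2 t) (Ioi 0) := by
  have h := (integrable_rpow_mul_expMoment_integrand hβ hβ').integral_prod_left
  simp only [MeasureTheory.integral_const_mul] at h
  simpa only [IntegrableOn, expMoment, intervalIntegral.integral_of_le (zero_le_one' ℝ)] using h

theorem integral_Ioi_rpow_mul_expMoment {β : ℝ} (hβ : -1 < β) (hβ' : β < 1 / 2) :
    ∫ t in Ioi (0 : ℝ), t ^ (2 * β + 1) * expMoment β 2 t =
      Real.Gamma (2 * β + 2) *
        (Real.Gamma (1 - 2 * β) * Real.Gamma (β + 1) / Real.Gamma (2 - β)) := by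
  have h := integral_integral_swap (f := fun t x : ℝ =>
    t ^ (2 * β + 1) * (x ^ 2 * Real.exp (-(t * x)) * (1 - x) ^ β))
    (integrable_rpow_mul_expMoment_integrand hβ hβ')
  simp only [MeasureTheory.integral_const_mul] at h
  simp only [expMoment, intervalIntegral.integral_of_le (zero_le_one' ℝ)]
  rw [h, ← intervalIntegral.integral_of_le (zero_le_one' ℝ)]
  have h1 := integral_rpow_mul_sub_rpow (u := -(2 * β)) (by linarith) hβ one_pos
  rw [one_rpow, one_mul, show -(2 * β) + 1 = 1 - 2 * β by ring,
    show -(2 * β) + β + 2 = 2 - β by ring] at h1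
  rw [← h1, ← intervalIntegral.integral_const_mul]
  refine intervalIntegral.integral_congr_ae (Eventually.of_forall fun x hx => ?_)
  rw [uIoc_of_le zero_le_one] at hx
  exact integral_Ioi_expMoment_integrand hβ hx.1

theorem rpow_mul_expMoment_eq {β : ℝ} (hβ : -1 < β) {t : ℝ} (ht : 0 < t) :
    t ^ (2 * β + 1) * expMoment β 2 t = t ^ β * expConvTwo β t / t ^ 2 := by
  rw [rpow_two_mul_add_one ht, expConvTwo_eq hβ ht]
  field_simp

theorem hasDerivAt_momentPrimitive {β : ℝ} (hβ : -1 < β) (hβ' : β < 1 / 2) {t : ℝ} (ht : 0 < t) :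
    HasDerivAt (momentPrimitive β) (t ^ β * expConvTwo β t / t ^ 2) t := by
  have hc : ContinuousOn (fun t => t ^ (2 * β + 1) * expMoment β 2 t) (Ioi 0) := by
    refine ContinuousOn.congr (f := fun t => t ^ β * expConvTwo β t / t ^ 2) (fun t ht => ?_)
      fun t ht => rpow_mul_expMoment_eq hβ ht
    have ht' : 0 < t := ht
    exact (((hasDerivAt_rpow_self ht').continuousAt.mul
      (hasDerivAt_expConvTwo hβ ht').continuousAt).div (by fun_prop)
        (by positivity)).continuousWithinAt
  rw [← rpow_mul_expMoment_eq hβ ht]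
  exact intervalIntegral.integral_hasDerivAt_right
    ((intervalIntegrable_iff_integrableOn_Ioc_of_le ht.le).2
      ((integrableOn_rpow_mul_expMoment hβ hβ').mono_set Ioc_subset_Ioi_self))
    (hc.stronglyMeasurableAtFilter isOpen_Ioi t ht) (hc.continuousAt (Ioi_mem_nhds ht))

theorem tendsto_momentPrimitive_nhdsGT {β : ℝ} (hβ : -1 < β) (hβ' : β < 1 / 2) :
    Tendsto (momentPrimitive β) (𝓝[>] 0) (𝓝 0) :=
  tendsto_primitive_nhdsGT ((intervalIntegrable_iff_integrableOn_Ioc_of_le zero_le_one).2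
      ((integrableOn_rpow_mul_expMoment hβ hβ').mono_set Ioc_subset_Ioi_self))

theorem tendsto_rpow_nhdsGT_zero {a : ℝ} (ha : 0 < a) :
    Tendsto (fun t : ℝ => t ^ a) (𝓝[>] 0) (𝓝 0) :=
  (Real.continuousAt_rpow_const 0 a (Or.inr ha.le)).tendsto.mono_left nhdsWithin_le_nhds |>.trans
    (by rw [zero_rpow ha.ne'])

theorem tendsto_expConvOne_nhdsGT {β : ℝ} (hβ : -1 < β) :
    Tendsto (expConvOne β) (𝓝[>] 0) (𝓝 0) := by
  have h1 : Tendsto (fun t : ℝ => t ^ (β + 1)) (𝓝[>] 0) (𝓝 0) :=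
    tendsto_rpow_nhdsGT_zero (by linarith)
  have hc := continuous_expConv hβ
  have h2 := Continuous.tendsto_nhdsGT_zero (f := fun t => (t + 1 + β) * expConv β t)
    (by fun_prop) (by simp [expConv])
  have h3 := h2.sub h1
  rw [sub_zero] at h3
  refine h3.congr' (eventually_nhdsWithin_of_forall fun t ht => ?_)
  have ht' : t ≠ 0 := (show 0 < t from ht).ne'
  rw [expConvOne, rpow_add_one ht']
  ring

theorem tendsto_rpow_mul_expMoment_nhdsGT {β : ℝ} (hβ : -1 < β) (n : ℕ) :
    Tendsto (fun t => t ^ (2 * β + 2) * expMoment β n t) (𝓝[>] 0) (𝓝 0) := by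
  have h1 : Tendsto (fun t : ℝ => t ^ (2 * β + 2) * expMoment β 0 0) (𝓝[>] 0) (𝓝 0) := by
    simpa using (tendsto_rpow_nhdsGT_zero (a := 2 * β + 2) (by linarith)).mul_const _
  refine squeeze_zero' ?_ ?_ h1
  · refine eventually_nhdsWithin_of_forall fun t ht => ?_
    exact mul_nonneg (rpow_nonneg (le_of_lt ht) _) (expMoment_nonneg _ _ _)
  · refine eventually_nhdsWithin_of_forall fun t ht => ?_
    exact mul_le_mul_of_nonneg_left (expMoment_le hβ n (le_of_lt ht)) (rpow_nonneg (le_of_lt ht) _)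

theorem tendsto_rpow_mul_expConvOne_nhdsGT {β : ℝ} (hβ : -1 < β) :
    Tendsto (fun t => t ^ β * expConvOne β t) (𝓝[>] 0) (𝓝 0) := by
  refine (tendsto_rpow_mul_expMoment_nhdsGT hβ 1).congr'
    (eventually_nhdsWithin_of_forall fun t ht => ?_)
  have ht' : 0 < t := ht
  beta_reduce
  rw [expConvOne_eq hβ ht, show 2 * β + 2 = (2 * β + 1) + 1 by ring, rpow_add_one ht'.ne',
    rpow_two_mul_add_one ht']
  ring

theorem tendsto_rpow_mul_expConvTwo_div_nhdsGT {β : ℝ} (hβ : -1 < β) :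
    Tendsto (fun t => t ^ β * expConvTwo β t / t) (𝓝[>] 0) (𝓝 0) := by
  refine (tendsto_rpow_mul_expMoment_nhdsGT hβ 2).congr'
    (eventually_nhdsWithin_of_forall fun t ht => ?_)
  have ht' : 0 < t := ht
  beta_reduce
  rw [expConvTwo_eq hβ ht, show 2 * β + 2 = (2 * β + 1) + 1 by ring, rpow_add_one ht'.ne',
    rpow_two_mul_add_one ht']
  field_simp

theorem tendsto_expConv_sq_nhdsGT {β : ℝ} (hβ : -1 < β) :
    Tendsto (fun t => expConv β t ^ 2) (𝓝[>] 0) (𝓝 0) :=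
  Continuous.tendsto_nhdsGT_zero ((continuous_expConv hβ).pow 2) (by simp [expConv])

theorem integral_exp_mul_expConv {β : ℝ} (hβ : -1 < β) {t : ℝ} (ht : 0 < t) :
    ∫ z in (0 : ℝ)..t, Real.exp z * expConv β z = Real.exp t * expConvOne β t := by
  have hc : Continuous fun z => Real.exp z * expConv β z :=
    Real.continuous_exp.mul (continuous_expConv hβ)
  refine eqOn_Ioi_of_hasDerivAt_of_tendsto (F := fun t => ∫ z in (0 : ℝ)..t, _)
    (G := fun t => Real.exp t * expConvOne β t)
    (fun t _ => hc.hasDerivAt_primitive t) (fun t ht => ?_)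
    (tendsto_primitive_nhdsGT (hc.intervalIntegrable 0 1)) ?_ ht
  · convert! (Real.hasDerivAt_exp t).mul (hasDerivAt_expConvOne hβ ht) using 1
    ring
  · simpa using (Real.continuous_exp.tendsto 0 |>.mono_left nhdsWithin_le_nhds).mul
      (tendsto_expConvOne_nhdsGT hβ)

/-- A closed form for the first three terms of `integral_sub_mul_sub_eq`. -/
noncomputable def quadraticPrimitive (β t : ℝ) : ℝ :=
  (1 - β) / 2 * momentPrimitive β t +
    (t ^ β * expConvOne β t + t ^ β * expConvTwo β t / t - expConv β t ^ 2) / 2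

theorem quadraticPrimitive_eq {β : ℝ} (hβ : -1 < β) (hβ' : β < 1 / 2) {t : ℝ} (ht : 0 < t) :
    (∫ z in (0 : ℝ)..t, expConv β z ^ 2) +
        (∫ z in (0 : ℝ)..t, Real.exp z * incGamma β z * expConv β z) -
        incGamma β t * (∫ z in (0 : ℝ)..t, Real.exp z * expConv β z) =
      quadraticPrimitive β t := by
  have hc := continuous_expConv hβ
  have hg := continuous_incGamma hβ
  have c1 : Continuous fun z => expConv β z ^ 2 := by fun_prop
  have c2 : Continuous fun z => Real.exp z * incGamma β z * expConv β z := by fun_prop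
  have c3 : Continuous fun z => Real.exp z * expConv β z := by fun_prop
  refine eqOn_Ioi_of_hasDerivAt_of_tendsto (F := fun t => _) (G := quadraticPrimitive β)
    (f := fun t => expConv β t ^ 2 - t ^ β * expConvOne β t) (fun t ht => ?_) (fun t ht => ?_)
    (Continuous.tendsto_nhdsGT_zero ((c1.primitive.add c2.primitive).sub (hg.mul c3.primitive))
      (by simp)) ?_ ht
  · convert! ((c1.hasDerivAt_primitive t).add (c2.hasDerivAt_primitive t)).sub
      ((hasDerivAt_incGamma hβ ht).mul (c3.hasDerivAt_primitive t)) using 1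
    rw [integral_exp_mul_expConv hβ ht]
    have : Real.exp (-t) * Real.exp t = 1 := by rw [← Real.exp_add]; simp
    linear_combination t ^ β * expConvOne β t * this
  · convert! ((hasDerivAt_momentPrimitive hβ hβ' ht).const_mul ((1 - β) / 2)).add
      (((((hasDerivAt_rpow_self (β := β) ht).mul (hasDerivAt_expConvOne hβ ht)).add
      (((hasDerivAt_rpow_self (β := β) ht).mul (hasDerivAt_expConvTwo hβ ht)).div
        (hasDerivAt_id t) ht.ne')).sub ((hasDerivAt_expConv hβ ht).pow 2)).div_const 2) using 1
    simp only [id, expConvTwo, Pi.mul_apply]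
    field_simp
    push_cast
    ring
  · have h := ((tendsto_momentPrimitive_nhdsGT hβ hβ').const_mul ((1 - β) / 2)).add
      ((((tendsto_rpow_mul_expConvOne_nhdsGT hβ).add
        (tendsto_rpow_mul_expConvTwo_div_nhdsGT hβ)).sub
          (tendsto_expConv_sq_nhdsGT hβ)).div_const 2)
    simpa [funext fun t => quadraticPrimitive.eq_def β t] using h

end FirstAntiderivative

section SecondAntiderivative

theorem integral_incGamma {β : ℝ} (hβ : -1 < β) {t : ℝ} (ht : 0 < t) :
    ∫ z in (0 : ℝ)..t, incGamma β z =
      (t - (β + 1)) * incGamma β t + t * t ^ β * Real.exp (-t) := by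
  have hc := continuous_incGamma hβ
  have h1 : Tendsto (fun t : ℝ => t ^ (β + 1)) (𝓝[>] 0) (𝓝 0) :=
    tendsto_rpow_nhdsGT_zero (by linarith)
  have h2 : Tendsto (fun t => (t - (β + 1)) * incGamma β t) (𝓝[>] 0) (𝓝 0) :=
    Continuous.tendsto_nhdsGT_zero (by fun_prop) (by simp [incGamma])
  have h3 : Tendsto (fun t => Real.exp (-t)) (𝓝[>] 0) (𝓝 1) :=
    ((by fun_prop : Continuous fun t => Real.exp (-t)).tendsto' 0 1 (by simp)).mono_left
      nhdsWithin_le_nhds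
  refine eqOn_Ioi_of_hasDerivAt_of_tendsto (F := fun t => ∫ z in (0 : ℝ)..t, _)
    (G := fun t => (t - (β + 1)) * incGamma β t + t * t ^ β * Real.exp (-t))
    (fun t _ => hc.hasDerivAt_primitive t) (fun t ht => ?_)
    (tendsto_primitive_nhdsGT (hc.intervalIntegrable 0 1)) ?_ ht
  · convert! (((hasDerivAt_id t).sub_const (β + 1)).mul (hasDerivAt_incGamma hβ ht)).add
      (((hasDerivAt_id t).mul (hasDerivAt_rpow_self (β := β) ht)).mul
        (hasDerivAt_neg t).exp) using 1
    simp only [id, Pi.mul_apply]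
    field_simp
    ring
  · have h := h2.add (h1.mul h3)
    rw [zero_mul, zero_add] at h
    refine h.congr' (eventually_nhdsWithin_of_forall fun t ht => ?_)
    beta_reduce
    rw [rpow_add_one (show 0 < t from ht).ne', mul_comm t]

theorem integral_exp_neg_mul_expConv {β : ℝ} (hβ : -1 < β) {t : ℝ} (ht : 0 < t) :
    ∫ s in (0 : ℝ)..t, Real.exp (-s) * expConv β s =
      (incGamma β t - Real.exp (-t) * expConv β t) / 2 := by
  have hc := continuous_expConv hβ
  have hg := continuous_incGamma hβ
  have hc' : Continuous fun s => Real.exp (-s) * expConv β s := by fun_prop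
  refine eqOn_Ioi_of_hasDerivAt_of_tendsto (F := fun t => ∫ z in (0 : ℝ)..t, _)
    (G := fun t => (incGamma β t - Real.exp (-t) * expConv β t) / 2)
    (fun t _ => hc'.hasDerivAt_primitive t) (fun t ht => ?_)
    (tendsto_primitive_nhdsGT (hc'.intervalIntegrable 0 1))
    (Continuous.tendsto_nhdsGT_zero (by fun_prop) (by simp [incGamma, expConv])) ht
  convert! ((hasDerivAt_incGamma hβ ht).sub
    ((hasDerivAt_neg t).exp.mul (hasDerivAt_expConv hβ ht))).div_const 2 using 1
  ring

/-- The antiderivative of `quadraticPrimitive` vanishing at `0`. -/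
noncomputable def quadraticSecondPrimitive (β t : ℝ) : ℝ :=
  (1 - β) / 2 * momentPrimitive β t * (t - (β + 3 / 2)) +
    (t ^ β * expConvOne β t - (3 + 2 * β) * (t ^ β * expConvTwo β t / t) + expConv β t ^ 2) / 4

/-- The antiderivative vanishing at `0` of the terms of `integral_sub_mul_sub_eq` with incomplete
Gamma integrals. -/
noncomputable def gammaSecondPrimitive (β t : ℝ) : ℝ :=
  ((t - (β + 1)) * incGamma β t + t ^ (β + 1) * Real.exp (-t)) ^ 2 / 2 -
    betaConst β * (((t - (2 * β + 2)) ^ 2 + (2 * β + 2)) * incGamma (2 * β + 1) t / 2 +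
      (t - (2 * β + 3)) * (t ^ (2 * β + 2) * Real.exp (-t)) / 2 +
      ((t - (2 * β + 2)) * incGamma (2 * β + 1) t + t ^ (2 * β + 2) * Real.exp (-t)) / 2 -
      (incGamma (2 * β + 1) t - Real.exp (-t) * expConv (2 * β + 1) t) / 4)

theorem hasDerivAt_quadraticSecondPrimitive {β : ℝ} (hβ : -1 < β) (hβ' : β < 1 / 2) {t : ℝ}
    (ht : 0 < t) :
    HasDerivAt (quadraticSecondPrimitive β) (quadraticPrimitive β t) t := by
  have hp : HasDerivAt (fun t : ℝ => t ^ β) _ t := hasDerivAt_rpow_self ht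
  convert! (((hasDerivAt_momentPrimitive hβ hβ' ht).const_mul ((1 - β) / 2)).mul
    ((hasDerivAt_id t).sub_const (β + 3 / 2))).add ((((hp.mul (hasDerivAt_expConvOne hβ ht)).sub
      (((hp.mul (hasDerivAt_expConvTwo hβ ht)).div (hasDerivAt_id t) ht.ne').const_mul
        (3 + 2 * β))).add ((hasDerivAt_expConv hβ ht).pow 2)).div_const 4) using 1
  simp only [id, quadraticPrimitive, expConvTwo, Pi.mul_apply]
  field_simp
  push_cast
  ring

theorem tendsto_quadraticSecondPrimitive {β : ℝ} (hβ : -1 < β) (hβ' : β < 1 / 2) :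
    Tendsto (quadraticSecondPrimitive β) (𝓝[>] 0) (𝓝 0) := by
  have h1 : Tendsto (fun t => t - (β + 3 / 2)) (𝓝[>] 0) (𝓝 (0 - (β + 3 / 2))) :=
    ((by fun_prop : Continuous fun t => t - (β + 3 / 2)).tendsto 0).mono_left nhdsWithin_le_nhds
  have h := (((tendsto_momentPrimitive_nhdsGT hβ hβ').const_mul ((1 - β) / 2)).mul h1).add
    ((((tendsto_rpow_mul_expConvOne_nhdsGT hβ).sub
      ((tendsto_rpow_mul_expConvTwo_div_nhdsGT hβ).const_mul (3 + 2 * β))).add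
        (tendsto_expConv_sq_nhdsGT hβ)).div_const 4)
  simpa [funext fun t => quadraticSecondPrimitive.eq_def β t] using h

theorem hasDerivAt_gammaSecondPrimitive {β : ℝ} (hβ : -1 < β) {t : ℝ} (ht : 0 < t) :
    HasDerivAt (gammaSecondPrimitive β)
      (incGamma β t * (∫ z in (0 : ℝ)..t, incGamma β z) -
        betaConst β * (∫ s in (0 : ℝ)..t, incGamma (2 * β + 1) s) -
        betaConst β * ∫ s in (0 : ℝ)..t, Real.exp (-s) * expConv (2 * β + 1) s) t := by
  have hβ₂ : -1 < 2 * β + 1 := by linarith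
  have hγ := hasDerivAt_incGamma hβ ht
  have hδ := hasDerivAt_incGamma hβ₂ ht
  have hid := hasDerivAt_id t
  have he : HasDerivAt (fun t : ℝ => Real.exp (-t)) _ t := (hasDerivAt_neg t).exp
  have hε := he.fun_mul (hasDerivAt_expConv hβ₂ ht)
  have hw := (hasDerivAt_rpow_self (β := 2 * β + 2) ht).fun_mul he
  have hv := (hasDerivAt_rpow_self (β := β + 1) ht).fun_mul he
  convert! ((((hid.sub_const (β + 1)).mul hγ).add hv).pow 2 |>.div_const 2).sub
    ((((((((hid.sub_const (2 * β + 2)).pow 2).add_const (2 * β + 2)).mul hδ).div_const 2).add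
      (((hid.sub_const (2 * β + 3)).mul hw).div_const 2)).add
      ((((hid.sub_const (2 * β + 2)).mul hδ).add hw).div_const 2)).sub
      ((hδ.sub hε).div_const 4) |>.const_mul (betaConst β)) using 1
  simp only [id, Pi.mul_apply, Pi.add_apply, Pi.pow_apply]
  rw [integral_incGamma hβ ht, integral_incGamma hβ₂ ht, integral_exp_neg_mul_expConv hβ₂ ht,
    show 2 * β + 2 = (2 * β + 1) + 1 by ring, rpow_add_one ht.ne' (2 * β + 1),
    rpow_add_one ht.ne' β]
  generalize t ^ β = p, t ^ (2 * β + 1) = q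
  field_simp
  push_cast
  ring

theorem tendsto_gammaSecondPrimitive {β : ℝ} (hβ : -1 < β) :
    Tendsto (gammaSecondPrimitive β) (𝓝[>] 0) (𝓝 0) := by
  have hβ₂ : -1 < 2 * β + 1 := by linarith
  have h1 := continuous_incGamma hβ
  have h2 := continuous_incGamma hβ₂
  have h3 := continuous_expConv hβ₂
  have h4 : Continuous fun t : ℝ => t ^ (β + 1) :=
    Real.continuous_rpow_const (by linarith)
  have h5 : Continuous fun t : ℝ => t ^ (2 * β + 2) :=
    Real.continuous_rpow_const (by linarith)
  have h : Continuous (gammaSecondPrimitive β) := by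
    unfold gammaSecondPrimitive
    fun_prop
  refine h.tendsto_nhdsGT_zero ?_
  simp [gammaSecondPrimitive, incGamma, expConv, zero_rpow (show β + 1 ≠ 0 by linarith),
    zero_rpow (show 2 * β + 2 ≠ 0 by linarith)]

/-- A closed form of `L1` in terms of one-variable integrals. -/
theorem L1_eq {β : ℝ} (hβ : -1 < β) (hβ' : β < 1 / 2) {T : ℝ} (hT : 0 < T) :
    L1 β T = quadraticSecondPrimitive β T + gammaSecondPrimitive β T := by
  have hβ₂ : -1 < 2 * β + 1 := by linarith
  have h1 := continuous_incGamma hβ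
  have h2 := continuous_incGamma hβ₂
  have h3 := continuous_expConv hβ₂
  have h4 := continuous_expConv hβ
  have c1 := (by fun_prop : Continuous fun z => expConv β z ^ 2).primitive
  have c2 := (by fun_prop : Continuous fun z => Real.exp z * incGamma β z * expConv β z).primitive
  have c3 := (by fun_prop : Continuous fun z => Real.exp z * expConv β z).primitive
  have c4 := h1.primitive
  have c5 := h2.primitive
  have c6 := (by fun_prop : Continuous fun s => Real.exp (-s) * expConv (2 * β + 1) s).primitive
  have hc : Continuous fun t => ((∫ z in (0 : ℝ)..t, expConv β z ^ 2) +
        (∫ z in (0 : ℝ)..t, Real.exp z * incGamma β z * expConv β z) -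
        incGamma β t * ∫ z in (0 : ℝ)..t, Real.exp z * expConv β z) +
      incGamma β t * (∫ z in (0 : ℝ)..t, incGamma β z) -
      betaConst β * (∫ s in (0 : ℝ)..t, incGamma (2 * β + 1) s) -
      betaConst β * ∫ s in (0 : ℝ)..t, Real.exp (-s) * expConv (2 * β + 1) s := by
    fun_prop
  have hpos : ∀ t ∈ uIoc 0 T, 0 < t := fun t ht => by
    rw [uIoc_of_le hT.le] at ht
    exact ht.1
  refine (intervalIntegral.integral_congr_ae (Eventually.of_forall fun t ht =>
    (triple_integral_eq hβ (hpos t ht)).trans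
      (integral_sub_mul_sub_eq hβ (hpos t ht).le))).trans ?_
  refine eqOn_Ioi_of_hasDerivAt_of_tendsto (F := fun T => ∫ t in (0 : ℝ)..T, _)
    (G := fun t => quadraticSecondPrimitive β t + gammaSecondPrimitive β t)
    (fun t _ => hc.hasDerivAt_primitive t) (fun t ht => ?_)
    (tendsto_primitive_nhdsGT (hc.intervalIntegrable 0 1))
    (by
      simpa using (tendsto_quadraticSecondPrimitive hβ hβ').add (tendsto_gammaSecondPrimitive hβ))
    hT
  rw [quadraticPrimitive_eq hβ hβ' ht]
  convert! (hasDerivAt_quadraticSecondPrimitive hβ hβ' ht).add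
    (hasDerivAt_gammaSecondPrimitive hβ ht) using 1
  ring

end SecondAntiderivative

section Asymptotic

/-- A function vanishing at infinity with derivative `O(t ^ (a - 1))`, `a < 0`, is `O(t ^ a)`. -/
theorem isBigO_rpow_of_hasDerivAt_of_tendsto {u r : ℝ → ℝ} {a : ℝ} (ha : a < 0)
    (hu : ∀ t, 0 < t → HasDerivAt u (r t) t) (hr : r =O[atTop] fun t => t ^ (a - 1))
    (hu0 : Tendsto u atTop (𝓝 0)) : u =O[atTop] fun t => t ^ a := by
  obtain ⟨C, hC0, hC⟩ := hr.exists_nonneg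
  obtain ⟨c, hc⟩ := (hC.bound.and (eventually_gt_atTop 0)).exists_forall_of_atTop
  refine IsBigO.of_bound (C / -a) (eventually_atTop.2 ⟨c, fun T hT => ?_⟩)
  have hpos : ∀ t, T ≤ t → 0 < t := fun t ht => (hc t (hT.trans ht)).2
  have hB : ∀ x, T ≤ x → HasDerivAt (fun x => C / a * (x ^ a - T ^ a)) (C * x ^ (a - 1)) x := by
    intro x hx
    convert! ((Real.hasDerivAt_rpow_const (p := a) (Or.inl (hpos x hx).ne')).sub_const
      (T ^ a)).const_mul (C / a) using 1
    have := ha.ne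
    field_simp
  have hle : ∀ S, T ≤ S → ‖u S - u T‖ ≤ C / -a * T ^ a := by
    intro S hS
    have h := image_norm_le_of_norm_deriv_right_le_deriv_boundary' (f := fun x => u x - u T)
      (f' := r) (a := T) (b := S) (B := fun x => C / a * (x ^ a - T ^ a))
      (fun x hx => ((hu x (hpos x hx.1)).sub_const _).continuousAt.continuousWithinAt)
      (fun x hx => ((hu x (hpos x hx.1)).sub_const _).hasDerivWithinAt) (by simp)
      (fun x hx => (hB x hx.1).continuousAt.continuousWithinAt)
      (fun x hx => (hB x hx.1).hasDerivWithinAt) (fun x hx => by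
        have := (hc x (hT.trans hx.1)).1
        rwa [Real.norm_of_nonneg (rpow_nonneg (hpos x hx.1).le _)] at this) ⟨hS, le_rfl⟩
    refine h.trans ?_
    have h1 : 0 ≤ C / -a * S ^ a :=
      mul_nonneg (div_nonneg hC0 (by linarith)) (rpow_nonneg (hpos S hS).le _)
    have h2 : C / a * (S ^ a - T ^ a) = C / -a * T ^ a - C / -a * S ^ a := by
      rw [div_neg]; ring
    linarith
  have hlim : Tendsto (fun S => ‖u S - u T‖) atTop (𝓝 ‖0 - u T‖) := (hu0.sub_const _).norm
  rw [Real.norm_of_nonneg (rpow_nonneg (hpos T le_rfl).le _)]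
  simpa using le_of_tendsto hlim ((eventually_ge_atTop T).mono hle)

theorem isBigO_rpow_mul_exp_neg (a b : ℝ) :
    (fun t : ℝ => t ^ a * Real.exp (-t)) =O[atTop] fun t => t ^ b := by
  have h := (isBigO_refl (fun t : ℝ => t ^ a) atTop).mul
    (isLittleO_exp_neg_mul_rpow_atTop one_pos (b - a)).isBigO
  refine (h.congr_left fun t => by rw [neg_one_mul]).congr'
    (EventuallyEq.refl _ _) ((eventually_gt_atTop 0).mono fun t ht => ?_)
  beta_reduce
  rw [← rpow_add ht, add_sub_cancel]

theorem isBigO_expConv {β : ℝ} (hβ : -1 < β) : expConv β =O[atTop] fun t => t ^ β :=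
  isBigO_rpow_of_hasDerivAt_add (fun _ => hasDerivAt_expConv hβ) (isBigO_refl _ _)

theorem hasDerivAt_rpow_sub_one {β t : ℝ} (ht : 0 < t) :
    HasDerivAt (fun t : ℝ => t ^ (β - 1)) ((β - 1) * t ^ (β - 2)) t := by
  have := Real.hasDerivAt_rpow_const (x := t) (p := β - 1) (Or.inl ht.ne')
  rwa [show β - 1 - 1 = β - 2 by ring] at this

theorem isBigO_expConv_sub {β : ℝ} (hβ : -1 < β) :
    (fun t => expConv β t - t ^ β + β * t ^ (β - 1)) =O[atTop] fun t => t ^ (β - 2) := by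
  refine isBigO_rpow_of_hasDerivAt_add (r := fun t => β * (β - 1) * t ^ (β - 2))
    (fun t ht => ?_) ((isBigO_refl _ _).const_mul_left _)
  convert! ((hasDerivAt_expConv hβ ht).sub (Real.hasDerivAt_rpow_const (p := β)
    (Or.inl ht.ne'))).add ((hasDerivAt_rpow_sub_one (β := β) ht).const_mul β) using 1
  ring

theorem isBigO_expConvOne_sub {β : ℝ} (hβ : -1 < β) :
    (fun t => expConvOne β t - t ^ β + 2 * β * t ^ (β - 1)) =O[atTop] fun t => t ^ (β - 2) := by
  refine isBigO_rpow_of_hasDerivAt_add (r := fun t =>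
    (expConv β t - t ^ β + β * t ^ (β - 1)) + 2 * β * (β - 1) * t ^ (β - 2))
    (fun t ht => ?_) ((isBigO_expConv_sub hβ).add ((isBigO_refl _ _).const_mul_left _))
  convert! ((hasDerivAt_expConvOne hβ ht).sub (Real.hasDerivAt_rpow_const (p := β)
    (Or.inl ht.ne'))).add ((hasDerivAt_rpow_sub_one (β := β) ht).const_mul (2 * β)) using 1
  ring

theorem isBigO_expConvTwo_sub {β : ℝ} (hβ : -1 < β) :
    (fun t => expConvTwo β t - 2 * t ^ β + 6 * β * t ^ (β - 1)) =O[atTop]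
      fun t => t ^ (β - 2) := by
  refine isBigO_rpow_of_hasDerivAt_add (r := fun t =>
    2 * (expConvOne β t - t ^ β + 2 * β * t ^ (β - 1)) + 6 * β * (β - 1) * t ^ (β - 2))
    (fun t ht => ?_) (((isBigO_expConvOne_sub hβ).const_mul_left 2).add
      ((isBigO_refl _ _).const_mul_left _))
  convert! ((hasDerivAt_expConvTwo hβ ht).sub ((Real.hasDerivAt_rpow_const (p := β)
    (Or.inl ht.ne')).const_mul 2)).add
      ((hasDerivAt_rpow_sub_one (β := β) ht).const_mul (6 * β)) using 1
  ring

theorem tendsto_rpow_atTop_zero {a : ℝ} (ha : a < 0) :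
    Tendsto (fun t : ℝ => t ^ a) atTop (𝓝 0) := by
  simpa using tendsto_rpow_neg_atTop (y := -a) (by linarith)

theorem isBigO_momentPrimitive_sub {β : ℝ} (hβ : -1 < β) (hβ' : β < 1 / 2) :
    (fun t => momentPrimitive β t - (∫ t in Ioi (0 : ℝ), t ^ (2 * β + 1) * expMoment β 2 t) -
      2 / (2 * β - 1) * t ^ (2 * β - 1) + 3 * β / (β - 1) * t ^ (2 * β - 2)) =O[atTop]
      fun t => t ^ (2 * β - 3) := by
  refine isBigO_rpow_of_hasDerivAt_of_tendsto (r := fun t =>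
    t ^ (β - 2) * (expConvTwo β t - 2 * t ^ β + 6 * β * t ^ (β - 1))) (by linarith)
    (fun t ht => ?_) ?_ ?_
  · have h1 := ((Real.hasDerivAt_rpow_const (p := 2 * β - 1) (Or.inl ht.ne')).const_mul
      (2 / (2 * β - 1)))
    have h2 := ((Real.hasDerivAt_rpow_const (p := 2 * β - 2) (Or.inl ht.ne')).const_mul
      (3 * β / (β - 1)))
    convert! (((hasDerivAt_momentPrimitive hβ hβ' ht).sub_const _).sub h1).add h2 using 1
    have e1 : t ^ (2 * β - 1 - 1) = t ^ (β - 2) * t ^ β := by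
      rw [← rpow_add ht]; ring_nf
    have e2 : t ^ (2 * β - 2 - 1) = t ^ (β - 2) * t ^ (β - 1) := by
      rw [← rpow_add ht]; ring_nf
    have e3 : t ^ β = t ^ (β - 2) * t ^ 2 := by
      rw [← rpow_natCast, ← rpow_add ht]; push_cast; ring_nf
    have n1 : 2 * β - 1 ≠ 0 := by linarith
    have n2 : β - 1 ≠ 0 := by linarith
    rw [e1, e2, e3]
    generalize t ^ (β - 2) = p, t ^ (β - 1) = q, expConvTwo β t = g
    field_simp
    ring
  · refine ((isBigO_refl (fun t : ℝ => t ^ (β - 2)) atTop).mul (isBigO_expConvTwo_sub hβ)).congr'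
      (EventuallyEq.refl _ _) ((eventually_gt_atTop 0).mono fun t ht => ?_)
    beta_reduce
    rw [← rpow_add ht]
    ring_nf
  · have h1 : Tendsto (momentPrimitive β) atTop _ :=
      intervalIntegral_tendsto_integral_Ioi 0 (integrableOn_rpow_mul_expMoment hβ hβ') tendsto_id
    have h2 := ((h1.sub_const (∫ t in Ioi (0 : ℝ), t ^ (2 * β + 1) * expMoment β 2 t)).sub
      ((tendsto_rpow_atTop_zero (a := 2 * β - 1)
      (by linarith)).const_mul (2 / (2 * β - 1)))).add
      ((tendsto_rpow_atTop_zero (a := 2 * β - 2) (by linarith)).const_mul (3 * β / (β - 1)))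
    simpa using h2

/-- Dividing an `O(t ^ a)` by `t ^ b t ^ (-n)` with `a = b - n` gives a bounded function. -/
theorem isBigO_one_of_isBigO_rpow {u : ℝ → ℝ} {a b : ℝ} {n : ℕ} (hab : a = b - n)
    (hu : u =O[atTop] fun t => t ^ a) :
    (fun t => u t * t ^ n / t ^ b) =O[atTop] fun _ => (1 : ℝ) := by
  have h := hu.mul (isBigO_refl (fun t : ℝ => t ^ n / t ^ b) atTop)
  refine (h.congr_left fun t => by ring).congr' (EventuallyEq.refl _ _)
    ((eventually_gt_atTop 0).mono fun t ht => ?_)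
  beta_reduce
  have := rpow_pos_of_pos ht b
  rw [hab, rpow_sub ht, rpow_natCast]
  field_simp

theorem isBigO_inv_one : (fun t : ℝ => t⁻¹) =O[atTop] fun _ => (1 : ℝ) :=
  tendsto_inv_atTop_zero.isBigO_one ℝ

theorem isBigO_quadraticSecondPrimitive_sub {β : ℝ} (hβ : -1 < β) (hβ' : β < 1 / 2) :
    (fun T => quadraticSecondPrimitive β T -
      ((1 - β) / 2 * (∫ t in Ioi (0 : ℝ), t ^ (2 * β + 1) * expMoment β 2 t) *
        (T - (β + 3 / 2)) + T ^ (2 * β) / (2 * (2 * β - 1)) -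
        2 * β / (2 * β - 1) * T ^ (2 * β - 1))) =O[atTop] fun T => T ^ (2 * β - 2) := by
  have h0 := isBigO_one_of_isBigO_rpow (b := β) (n := 2) (by norm_num) (isBigO_expConv_sub hβ)
  have h1 := isBigO_one_of_isBigO_rpow (b := β) (n := 2) (by norm_num) (isBigO_expConvOne_sub hβ)
  have h2 := isBigO_one_of_isBigO_rpow (b := β) (n := 2) (by norm_num) (isBigO_expConvTwo_sub hβ)
  have h3 := isBigO_one_of_isBigO_rpow (b := 2 * β) (n := 3) (by norm_num)
    (isBigO_momentPrimitive_sub hβ hβ')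
  have hi := isBigO_inv_one
  have hc : ∀ c : ℝ, (fun _ : ℝ => c) =O[atTop] fun _ : ℝ => (1 : ℝ) := fun c =>
    isBigO_const_const c one_ne_zero _
  have mul1 : ∀ {f g : ℝ → ℝ}, f =O[atTop] (fun _ => (1 : ℝ)) → g =O[atTop] (fun _ => (1 : ℝ)) →
      (fun t => f t * g t) =O[atTop] fun _ => (1 : ℝ) := fun hf hg => by
    simpa using hf.mul hg
  set v0 := fun t => (expConv β t - t ^ β + β * t ^ (β - 1)) * t ^ 2 / t ^ β with hv0
  set v1 := fun t => (expConvOne β t - t ^ β + 2 * β * t ^ (β - 1)) * t ^ 2 / t ^ β with hv1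
  set v2 := fun t => (expConvTwo β t - 2 * t ^ β + 6 * β * t ^ (β - 1)) * t ^ 2 / t ^ β with hv2
  set J := ∫ t in Ioi (0 : ℝ), t ^ (2 * β + 1) * expMoment β 2 t
  set ρ := fun t => (momentPrimitive β t - J - 2 / (2 * β - 1) * t ^ (2 * β - 1) +
    3 * β / (β - 1) * t ^ (2 * β - 2)) * t ^ 3 / t ^ (2 * β) with hρ
  have key := (mul1 (hc ((1 - β) / 2)) (mul1 h3 ((hc 1).sub (mul1 (hc (β + 3 / 2)) hi)))).add
    ((((h1.sub (mul1 (hc (3 + 2 * β)) (mul1 h2 hi))).add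
      (mul1 (hc 2) (mul1 ((hc 1).sub (mul1 (hc β) hi)) h0))).add
      (mul1 (mul1 h0 hi) (mul1 h0 hi))).add (hc (β ^ 2 + 6 * β * (3 + 2 * β))) |>.const_mul_left
        (1 / 4) |>.add (hc (-(3 * β / 2 * (β + 3 / 2)))))
  refine (key.mul (isBigO_refl (fun t : ℝ => t ^ (2 * β - 2)) atTop)).congr'
    ((eventually_gt_atTop 0).mono fun t ht => ?_) (by simp)
  have hp := rpow_pos_of_pos ht β
  have e1 : t ^ (β - 1) = t ^ β / t := by rw [rpow_sub_one ht.ne']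
  have e2 : t ^ (2 * β) = t ^ β * t ^ β := by rw [two_mul, rpow_add ht]
  have e3 : t ^ (2 * β - 1) = t ^ β * t ^ β / t := by rw [rpow_sub_one ht.ne', e2]
  have e4 : t ^ (2 * β - 2) = t ^ β * t ^ β / t ^ 2 := by
    rw [rpow_sub ht, e2, rpow_two]
  have n1 : 2 * β - 1 ≠ 0 := by linarith
  have n2 : β - 1 ≠ 0 := by linarith
  simp only [hv0, hv1, hv2, hρ, quadraticSecondPrimitive]
  rw [e1, e2, e3, e4]
  generalize t ^ β = p at hp
  have n3 : β * 2 - 1 ≠ 0 := by linarith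
  have n4 : -1 + β * 2 ≠ 0 := by linarith
  field_simp
  ring

end Asymptotic

section GammaAsymptotic

theorem tendsto_incGamma {β : ℝ} (hβ : -1 < β) :
    Tendsto (incGamma β) atTop (𝓝 (Real.Gamma (β + 1))) := by
  have hi := Real.GammaIntegral_convergent (s := β + 1) (by linarith)
  have h : Tendsto (fun T => ∫ x in (0 : ℝ)..T, Real.exp (-x) * x ^ (β + 1 - 1)) atTop _ :=
    intervalIntegral_tendsto_integral_Ioi 0 hi tendsto_id
  rw [← Real.Gamma_eq_integral (by linarith)] at h
  simp only [add_sub_cancel_right, mul_comm (Real.exp _)] at h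
  exact h

theorem isBigO_Gamma_sub_incGamma {β a : ℝ} (hβ : -1 < β) (ha : a < 0) :
    (fun t => Real.Gamma (β + 1) - incGamma β t) =O[atTop] fun t => t ^ a := by
  refine isBigO_rpow_of_hasDerivAt_of_tendsto (r := fun t => -(t ^ β * Real.exp (-t))) ha
    (fun t ht => (hasDerivAt_incGamma hβ ht).const_sub _)
    (isBigO_rpow_mul_exp_neg β (a - 1)).neg_left ?_
  simpa using (tendsto_incGamma hβ).const_sub (Real.Gamma (β + 1))

theorem isBigO_exp_neg_mul_expConv {β : ℝ} (hβ : -1 < β) (a : ℝ) :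
    (fun t => Real.exp (-t) * expConv β t) =O[atTop] fun t => t ^ a := by
  refine IsBigO.trans ?_ (isBigO_rpow_mul_exp_neg β a)
  refine ((isBigO_refl (fun t : ℝ => Real.exp (-t)) atTop).mul (isBigO_expConv hβ)).congr_right
    fun t => mul_comm _ _

theorem isBigO_gammaSecondPrimitive_sub {β : ℝ} (hβ : -1 < β) (hβ' : β < 1 / 2) :
    (fun T => gammaSecondPrimitive β T -
      (Real.Gamma (β + 1) ^ 2 * (β + 1 / 2) * (T - (β + 3 / 2)) -
        (β + 1) ^ 2 * Real.Gamma (β + 1) ^ 2 / 2)) =O[atTop] fun T => T ^ (2 * β - 2) := by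
  have hs : 2 * β - 2 < 0 := by linarith
  set s := 2 * β - 2 with hs_def
  have h0 : (fun t : ℝ => t ^ s) =O[atTop] fun _ => (1 : ℝ) :=
    (tendsto_rpow_atTop_zero hs).isBigO_one ℝ
  have hx := isBigO_one_of_isBigO_rpow (b := s) (n := 2) rfl
    (isBigO_Gamma_sub_incGamma (β := β) (a := s - (2 : ℕ)) hβ (by push_cast; linarith))
  have hy := isBigO_one_of_isBigO_rpow (b := s) (n := 2) rfl
    (isBigO_Gamma_sub_incGamma (β := 2 * β + 1) (a := s - (2 : ℕ)) (by linarith)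
      (by push_cast; linarith))
  have hv := isBigO_one_of_isBigO_rpow (b := s) (n := 2) rfl
    (isBigO_rpow_mul_exp_neg (β + 1) (s - (2 : ℕ)))
  have hw := isBigO_one_of_isBigO_rpow (b := s) (n := 2) rfl
    (isBigO_rpow_mul_exp_neg (2 * β + 2) (s - (2 : ℕ)))
  have he := isBigO_one_of_isBigO_rpow (b := s) (n := 2) rfl
    (isBigO_exp_neg_mul_expConv (β := 2 * β + 1) (by linarith) (s - (2 : ℕ)))
  have hi := isBigO_inv_one
  have hc : ∀ c : ℝ, (fun _ : ℝ => c) =O[atTop] fun _ : ℝ => (1 : ℝ) := fun c =>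
    isBigO_const_const c one_ne_zero _
  have mul1 : ∀ {f g : ℝ → ℝ}, f =O[atTop] (fun _ => (1 : ℝ)) → g =O[atTop] (fun _ => (1 : ℝ)) →
      (fun t => f t * g t) =O[atTop] fun _ => (1 : ℝ) := fun hf hg => by
    simpa using hf.mul hg
  set x := fun t => (Real.Gamma (β + 1) - incGamma β t) * t ^ 2 / t ^ s with hx_def
  set y := fun t => (Real.Gamma (2 * β + 1 + 1) - incGamma (2 * β + 1) t) * t ^ 2 / t ^ s
    with hy_def
  set v := fun t : ℝ => t ^ (β + 1) * Real.exp (-t) * t ^ 2 / t ^ s with hv_def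
  set w := fun t : ℝ => t ^ (2 * β + 2) * Real.exp (-t) * t ^ 2 / t ^ s with hw_def
  set e := fun t => Real.exp (-t) * expConv (2 * β + 1) t * t ^ 2 / t ^ s with he_def
  set G := Real.Gamma (β + 1)
  have hl : ∀ c : ℝ, (fun t : ℝ => 1 - c * t⁻¹) =O[atTop] fun _ => (1 : ℝ) := fun c =>
    (hc 1).sub (mul1 (hc c) hi)
  have hZ := (mul1 hv hi).sub (mul1 (hl (β + 1)) hx)
  have key := ((mul1 (hc G) (mul1 (hl (β + 1)) hZ)).add
    (mul1 (hc (1 / 2)) (mul1 h0 (mul1 (mul1 hi hZ) (mul1 hi hZ))))).sub (mul1 (hc (betaConst β))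
      (((mul1 (hc (-1 / 2)) (mul1 ((mul1 (hl (2 * β + 2)) (hl (2 * β + 2))).add
        (mul1 (hc (2 * β + 2)) (mul1 hi hi))) hy)).add
        (mul1 (hc (1 / 2)) (mul1 hi (mul1 (hl (2 * β + 3)) hw)))).add
      ((mul1 (hc (1 / 2)) ((mul1 (mul1 hi hi) hw).sub (mul1 hi (mul1 (hl (2 * β + 2)) hy)))).add
        ((mul1 (hc (1 / 4)) (mul1 (mul1 hi hi) hy)).add
          (mul1 (hc (1 / 4)) (mul1 (mul1 hi hi) he))))))
  refine (key.mul (isBigO_refl (fun t : ℝ => t ^ s) atTop)).congr'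
    ((eventually_gt_atTop 0).mono fun t ht => ?_) (by simp)
  have hp := rpow_pos_of_pos ht s
  have hD : Real.Gamma (2 * β + 1 + 1) ≠ 0 := (Real.Gamma_pos_of_pos (by linarith)).ne'
  have hb : betaConst β = G * G / Real.Gamma (2 * β + 1 + 1) := by
    simp only [betaConst, G]; ring_nf
  simp only [hx_def, hy_def, hv_def, hw_def, he_def, gammaSecondPrimitive]
  rw [hb]
  generalize Real.Gamma (2 * β + 1 + 1) = D at hD
  generalize t ^ s = p, t ^ (β + 1) = v', t ^ (2 * β + 2) = w', Real.exp (-t) = e' at hp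
  field_simp
  ring

end GammaAsymptotic

section Constants

theorem Gamma_mul_Gamma_eq_pi_div_two {β : ℝ} :
    Real.Gamma (2 * β + 2) * Real.Gamma (1 - 2 * β) * (π / 2) =
      Real.Gamma (β + 1) * Real.Gamma (1 - β) *
        (Real.Gamma (β + 3 / 2) * Real.Gamma (1 / 2 - β)) := by
  have h1 := Real.Gamma_mul_Gamma_add_half (β + 1)
  have h2 := Real.Gamma_mul_Gamma_add_half (1 / 2 - β)
  rw [show β + 1 + 1 / 2 = β + 3 / 2 by ring, show 2 * (β + 1) = 2 * β + 2 by ring] at h1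
  rw [show 1 / 2 - β + 1 / 2 = 1 - β by ring, show 2 * (1 / 2 - β) = 1 - 2 * β by ring] at h2
  have h3 : (2 : ℝ) ^ (1 - (2 * β + 2)) * 2 ^ (1 - (1 - 2 * β)) = 1 / 2 := by
    rw [← rpow_add two_pos, show 1 - (2 * β + 2) + (1 - (1 - 2 * β)) = -1 by ring,
      rpow_neg_one, one_div]
  calc _ = Real.Gamma (2 * β + 2) * Real.Gamma (1 - 2 * β) *
        ((2 : ℝ) ^ (1 - (2 * β + 2)) * 2 ^ (1 - (1 - 2 * β))) * (√π * √π) := by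
        rw [h3, Real.mul_self_sqrt pi_pos.le]; ring
    _ = (Real.Gamma (2 * β + 2) * 2 ^ (1 - (2 * β + 2)) * √π) *
        (Real.Gamma (1 - 2 * β) * 2 ^ (1 - (1 - 2 * β)) * √π) := by ring
    _ = _ := by rw [← h1, ← h2]; ring

theorem sigmaH2_eq {H : ℝ} (hH : 0 < H) (hH' : H < 3 / 4) :
    sigmaH2 H = 4 * H - 1 + 2 * (Real.Gamma (2 * H + 1 / 2) * Real.Gamma (3 / 2 - 2 * H)) / π := by
  unfold sigmaH2
  split_ifs with h
  · subst h
    norm_num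
  · have hne : 2 * H - 1 / 2 ≠ 0 := fun h' => h (by linarith)
    have h1 : Real.Gamma (2 * H + 1 / 2) = (2 * H - 1 / 2) * Real.Gamma (2 * H - 1 / 2) := by
      rw [← Real.Gamma_add_one hne]; ring_nf
    have h2 := Real.Gamma_mul_Gamma_one_sub (2 * H - 1 / 2)
    rw [show 1 - (2 * H - 1 / 2) = 3 / 2 - 2 * H by ring,
      show π * (2 * H - 1 / 2) = 2 * H * π - π / 2 by ring, Real.sin_sub_pi_div_two] at h2
    rw [h1, mul_assoc (2 * H - 1 / 2), h2]
    field_simp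
    ring

theorem integral_moment_add_eq_sigmaH2 {H : ℝ} (hH : 0 < H) (hH' : H < 3 / 4) :
    (1 - (2 * H - 1)) / 2 *
        (∫ t in Ioi (0 : ℝ), t ^ (2 * (2 * H - 1) + 1) * expMoment (2 * H - 1) 2 t) +
      Real.Gamma (2 * H) ^ 2 * (2 * H - 1 / 2) = 1 / 2 * Real.Gamma (2 * H) ^ 2 * sigmaH2 H := by
  have h1 := Gamma_mul_Gamma_eq_pi_div_two (β := 2 * H - 1)
  rw [integral_Ioi_rpow_mul_expMoment (by linarith) (by linarith), sigmaH2_eq hH hH',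
    show 2 - (2 * H - 1) = (1 - (2 * H - 1)) + 1 by ring,
    Real.Gamma_add_one (s := 1 - (2 * H - 1)) (by linarith)]
  rw [show 2 * H - 1 + 1 = 2 * H by ring, show 2 * H - 1 + 3 / 2 = 2 * H + 1 / 2 by ring,
    show 1 / 2 - (2 * H - 1) = 3 / 2 - 2 * H by ring] at h1
  rw [show 2 * H - 1 + 1 = 2 * H by ring]
  have hG : Real.Gamma (1 - (2 * H - 1)) ≠ 0 := (Real.Gamma_pos_of_pos (by linarith)).ne'
  have hn : 1 - (2 * H - 1) ≠ 0 := by linarith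
  have h2 : Real.Gamma (2 * (2 * H - 1) + 2) * Real.Gamma (1 - 2 * (2 * H - 1)) =
      Real.Gamma (2 * H) * Real.Gamma (1 - (2 * H - 1)) *
        (Real.Gamma (2 * H + 1 / 2) * Real.Gamma (3 / 2 - 2 * H)) * 2 / π := by
    rw [← h1]; field_simp
  rw [← mul_div_assoc, ← mul_assoc, h2]
  generalize 1 - (2 * H - 1) = d at hG hn ⊢
  field_simp
  ring

theorem isBigO_L1_sub {H : ℝ} (hH : 0 < H) (hH' : H < 3 / 4) :
    (fun T => L1 (2 * H - 1) T -
      ((1/2) * (Real.Gamma (2 * H)) ^ 2 * sigmaH2 H * (T - (4 * H + 1) / 2)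
        - 2 * H ^ 2 * (Real.Gamma (2 * H)) ^ 2
        + T ^ (4 * H - 2) / (2 * (4 * H - 3))
        - ((4 * H - 2) / (4 * H - 3)) * T ^ (4 * H - 3))) =O[atTop]
      fun T => T ^ (4 * H - 4) := by
  have hβ : -1 < 2 * H - 1 := by linarith
  have hβ' : 2 * H - 1 < 1 / 2 := by linarith
  have h := (isBigO_quadraticSecondPrimitive_sub hβ hβ').add
    (isBigO_gammaSecondPrimitive_sub hβ hβ')
  rw [show 2 * (2 * H - 1) - 2 = 4 * H - 4 by ring] at h
  refine h.congr' ((eventually_gt_atTop 0).mono fun T hT => ?_) (EventuallyEq.refl _ _)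
  have hσ := integral_moment_add_eq_sigmaH2 hH hH'
  beta_reduce
  rw [L1_eq hβ hβ' hT, ← hσ]
  rw [show 2 * H - 1 + 1 = 2 * H by ring, show 2 * (2 * H - 1) - 1 = 4 * H - 3 by ring,
    show 2 * (2 * H - 1) = 4 * H - 2 by ring]
  ring

end Constants

end RosenblattAsymptotics

theorem stmt_16 (H : ℝ) (hH : H ∈ Set.Ioo (0 : ℝ) (3/4)) :
    ∃ M c : ℝ, ∀ T > c,
      |L1 (2 * H - 1) T -
        ((1/2) * (Real.Gamma (2 * H)) ^ 2 * sigmaH2 H * (T - (4 * H + 1) / 2)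
          - 2 * H ^ 2 * (Real.Gamma (2 * H)) ^ 2
          + T ^ (4 * H - 2) / (2 * (4 * H - 3))
          - ((4 * H - 2) / (4 * H - 3)) * T ^ (4 * H - 3))|
        ≤ M * T ^ (4 * H - 4) := by
  obtain ⟨M, hM⟩ := (RosenblattAsymptotics.isBigO_L1_sub hH.1 hH.2).bound
  obtain ⟨c, hc⟩ := Filter.eventually_atTop.1 hM
  refine ⟨M, max c 0, fun T hT => ?_⟩
  have h := hc T ((le_max_left c 0).trans hT.le)
  rwa [Real.norm_eq_abs, Real.norm_of_nonneg
    (Real.rpow_nonneg ((le_max_right c 0).trans hT.le) _)] at h
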